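/- arXiv:2403.19089 — 3 statements merged into one kernel-verified Lean document; each statement's English description precedes it below -/
import Mathlib

section
/- Let n ≥ 3 and define, for α ∈ [-1,1], ψ_n(α) = (1/(2^{n-2} Γ(n/2)²)) ∫₀¹ (1-t²)^{(n-2)/2} [∫₀^∞∫₀^∞ exp(-(r² + r'² - 2rr't α)/2) (rr')^{n-2} dr dr'] dt. Then for all continuously differentiable 0-homogeneous functions u, v : ℝⁿ\{0} → ℝ, cov_{σ_{n-1}}(u,v) = ∫_{S^{n-1}}∫_{S^{n-1}} ⟨∇u(x), ∇v(y)⟩ ψ_n(⟨x,y⟩) dσ_{n-1}(x) dσ_{n-1}(y), where the covariance and the integrals on the sphere are with respect to the restriction of u, v to S^{n-1}. -/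
open MeasureTheory Real
open scoped RealInnerProductSpace

/-- The standard Gaussian measure on `ℝⁿ`. -/
noncomputable def stdGaussian (n : ℕ) : Measure (EuclideanSpace ℝ (Fin n)) :=
  volume.withDensity fun x =>
    ENNReal.ofReal ((2 * π) ^ (-(n : ℝ) / 2) * Real.exp (-‖x‖ ^ 2 / 2))

/-- The uniform (rotation-invariant) probability measure on the unit sphere `S^{n-1}`,
realized as the image of the standard Gaussian measure under `x ↦ x/‖x‖`. -/
noncomputable def sphereUniform (n : ℕ) : Measure (EuclideanSpace ℝ (Fin n)) :=
  (stdGaussian n).map fun x => ‖x‖⁻¹ • x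

/-- The mixing density `ψ_n(α)`. -/
noncomputable def psi (n : ℕ) (α : ℝ) : ℝ :=
  (1 / (2 ^ ((n : ℝ) - 2) * Real.Gamma ((n : ℝ) / 2) ^ 2)) *
    ∫ t in Set.Ioo (0 : ℝ) 1,
      (1 - t ^ 2) ^ (((n : ℝ) - 2) / 2) *
        ∫ r in Set.Ioi (0 : ℝ), ∫ r' in Set.Ioi (0 : ℝ),
          Real.exp (-(r ^ 2 + r' ^ 2 - 2 * r * r' * t * α) / 2) * (r * r') ^ ((n : ℝ) - 2)


lemma stdGaussian_eq (n : ℕ) : stdGaussian n = volume.withDensity fun x =>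
    ENNReal.ofReal ((2 * π) ^ (-(n : ℝ) / 2) * Real.exp (-‖x‖ ^ 2 / 2)) := rfl

lemma cg_lintegral_gauss (n : ℕ) (f : EuclideanSpace ℝ (Fin n) → ENNReal) (hf : Measurable f) :
    ∫⁻ x, f x ∂(stdGaussian n) =
      ∫⁻ x, ENNReal.ofReal ((2 * π) ^ (-(n : ℝ) / 2) * Real.exp (-‖x‖ ^ 2 / 2)) * f x := by
  rw [stdGaussian_eq, lintegral_withDensity_eq_lintegral_mul _ (by fun_prop) hf]
  rfl

lemma cg_integrable_exp (n : ℕ) :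
    Integrable (fun x : EuclideanSpace ℝ (Fin n) => Real.exp (-‖x‖ ^ 2 / 2)) := by
  have := GaussianFourier.integrable_cexp_neg_mul_sq_norm_add (V := EuclideanSpace ℝ (Fin n))
    (b := 1/2) (by norm_num) 0 0
  have h2 := this.norm
  refine h2.congr (Filter.Eventually.of_forall fun x => ?_)
  simp only [Complex.norm_exp]
  congr 1
  simp
  norm_cast
  ring

instance cg_prob (n : ℕ) : IsProbabilityMeasure (stdGaussian n) := by
  constructor
  rw [stdGaussian_eq, withDensity_apply _ MeasurableSet.univ, Measure.restrict_univ,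
    ← ofReal_integral_eq_lintegral_ofReal]
  · have := GaussianFourier.integral_rexp_neg_mul_sq_norm (V := EuclideanSpace ℝ (Fin n))
      (b := 1/2) (by norm_num)
    rw [integral_const_mul]
    have e : ∀ x : EuclideanSpace ℝ (Fin n), -‖x‖^2/2 = -(1/2) * ‖x‖^2 := fun x => by ring
    simp_rw [e]
    rw [this]
    simp only [finrank_euclideanSpace, Fintype.card_fin]
    rw [show π / (1/2) = 2 * π by ring, ← Real.rpow_add (by positivity)]
    rw [show -(n:ℝ)/2 + (n:ℝ)/2 = 0 by ring]
    simp
  · exact (cg_integrable_exp n).const_mul _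
  · exact Filter.Eventually.of_forall fun x => by positivity

lemma cg_polar0 (n : ℕ) (hn : 3 ≤ n) (f : EuclideanSpace ℝ (Fin n) → ENNReal) (hf : Measurable f) :
    ∫⁻ x, f x = ∫⁻ θ, (∫⁻ r in Set.Ioi (0:ℝ), ENNReal.ofReal (r ^ (n - 1)) * f (r • (θ : EuclideanSpace ℝ (Fin n))))
      ∂(volume : Measure (EuclideanSpace ℝ (Fin n))).toSphere := by
  have : Nonempty (Fin n) := ⟨⟨0, by omega⟩⟩
  have h1 : ∫⁻ x, f x = ∫⁻ x : ({(0 : EuclideanSpace ℝ (Fin n))}ᶜ : Set _), f x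
      ∂(Measure.comap Subtype.val volume) := by
    rw [lintegral_subtype_comap (measurableSet_singleton _).compl, restrict_compl_singleton]
  have h2 := (volume : Measure (EuclideanSpace ℝ (Fin n))).measurePreserving_homeomorphUnitSphereProd
  have h3 := h2.lintegral_comp_emb (Homeomorph.measurableEmbedding _)
    (fun p => f ((p.2 : ℝ) • (p.1 : EuclideanSpace ℝ (Fin n))))
  rw [h1]
  have h4 : ∀ x : ({(0 : EuclideanSpace ℝ (Fin n))}ᶜ : Set _),
    f (((homeomorphUnitSphereProd _ x).2 : ℝ) • ((homeomorphUnitSphereProd _ x).1 : EuclideanSpace ℝ (Fin n))) = f x := by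
    intro x
    have hx : ‖(x : EuclideanSpace ℝ (Fin n))‖ ≠ 0 := norm_ne_zero_iff.mpr x.2
    simp [smul_smul, hx]
  simp_rw [h4] at h3
  rw [h3, lintegral_prod _ (by fun_prop)]
  refine lintegral_congr fun θ => ?_
  rw [Measure.volumeIoiPow, lintegral_withDensity_eq_lintegral_mul _ (by fun_prop) (by fun_prop)]
  simp only [Pi.mul_apply, finrank_euclideanSpace, Fintype.card_fin]
  rw [lintegral_subtype_comap measurableSet_Ioi (fun r : ℝ => ENNReal.ofReal (r ^ (n - 1)) * f (r • (θ : EuclideanSpace ℝ (Fin n))))]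

/-- The radial constant. -/
noncomputable def cgK (n : ℕ) : ℝ := (2 * π) ^ (-(n : ℝ) / 2) * (2 ^ ((n : ℝ) / 2 - 1) * Real.Gamma ((n : ℝ) / 2))

lemma cgK_pos (n : ℕ) (hn : 3 ≤ n) : 0 < cgK n := by
  have : 0 < Real.Gamma ((n : ℝ) / 2) := Real.Gamma_pos_of_pos (by
    have : (3:ℝ) ≤ n := by exact_mod_cast hn
    linarith)
  unfold cgK
  positivity

lemma cg_radial (n : ℕ) (k : ℕ) :
    ∫⁻ r in Set.Ioi (0:ℝ), ENNReal.ofReal (r ^ k) * ENNReal.ofReal ((2 * π) ^ (-(n : ℝ) / 2) * Real.exp (- r ^ 2 / 2))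
     = ENNReal.ofReal ((2 * π) ^ (-(n : ℝ) / 2) * (2 ^ (((k:ℝ) + 1) / 2 - 1) * Real.Gamma (((k:ℝ) + 1) / 2))) := by
  have hi := integrableOn_rpow_mul_exp_neg_mul_rpow (s := k) (p := 2) (b := 1/2)
    (by have : (0:ℝ) ≤ k := by positivity
        linarith) (by norm_num) (by norm_num)
  have hv := integral_rpow_mul_exp_neg_mul_rpow (q := k) (p := 2) (b := 1/2)
    (by norm_num) (by have : (0:ℝ) ≤ k := by positivity
                      linarith) (by norm_num)
  have e : ∀ r ∈ Set.Ioi (0:ℝ), ENNReal.ofReal (r ^ k) * ENNReal.ofReal ((2 * π) ^ (-(n : ℝ) / 2) * Real.exp (- r ^ 2 / 2))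
      = ENNReal.ofReal ((2 * π) ^ (-(n : ℝ) / 2)) * ENNReal.ofReal (r ^ (k:ℝ) * Real.exp (-(1/2) * r ^ (2:ℝ))) := by
    intro r hr
    have hr0 : (0:ℝ) < r := hr
    rw [← ENNReal.ofReal_mul (by positivity), ← ENNReal.ofReal_mul (by positivity)]
    congr 1
    rw [Real.rpow_natCast, Real.rpow_two]
    ring_nf
  rw [setLIntegral_congr_fun measurableSet_Ioi e, lintegral_const_mul _ (by fun_prop),
    ← ofReal_integral_eq_lintegral_ofReal hi, hv, ← ENNReal.ofReal_mul (by positivity)]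
  · congr 1
    rw [Real.rpow_sub (by norm_num), one_div, Real.inv_rpow (by norm_num), ← Real.rpow_neg (by norm_num)]
    rw [neg_div (2:ℝ) ((k:ℝ)+1), neg_neg, Real.rpow_one]
    ring
  · refine (ae_restrict_mem measurableSet_Ioi).mono fun r hr => ?_
    have hr0 : (0:ℝ) < r := hr
    show 0 ≤ _
    positivity

lemma cg_sphere (n : ℕ) (hn : 3 ≤ n) (g : EuclideanSpace ℝ (Fin n) → ENNReal) (hg : Measurable g) :
    ∫⁻ x, g x ∂(sphereUniform n) = ENNReal.ofReal (cgK n) * ∫⁻ θ, g (θ : EuclideanSpace ℝ (Fin n))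
      ∂(volume : Measure (EuclideanSpace ℝ (Fin n))).toSphere := by
  rw [sphereUniform, lintegral_map hg (by fun_prop), cg_lintegral_gauss _ _ (by fun_prop),
    cg_polar0 n hn _ (by fun_prop)]
  rw [← lintegral_const_mul _ (by fun_prop)]
  refine lintegral_congr fun θ => ?_
  have hθ : ‖(θ : EuclideanSpace ℝ (Fin n))‖ = 1 := by simp
  have e : ∀ r ∈ Set.Ioi (0:ℝ), ENNReal.ofReal (r ^ (n - 1)) *
        (ENNReal.ofReal ((2 * π) ^ (-(n:ℝ) / 2) * rexp (-‖r • (θ : EuclideanSpace ℝ (Fin n))‖ ^ 2 / 2)) *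
          g (‖r • (θ : EuclideanSpace ℝ (Fin n))‖⁻¹ • r • (θ : EuclideanSpace ℝ (Fin n))))
      = (ENNReal.ofReal (r ^ (n-1)) * ENNReal.ofReal ((2 * π) ^ (-(n : ℝ) / 2) * Real.exp (- r ^ 2 / 2))) * g θ := by
    intro r hr
    have hr0 : (0:ℝ) < r := hr
    rw [norm_smul, hθ, mul_one, Real.norm_of_nonneg hr0.le, smul_smul, inv_mul_cancel₀ hr0.ne', one_smul, mul_assoc]
  rw [setLIntegral_congr_fun measurableSet_Ioi e, lintegral_mul_const _ (by fun_prop), cg_radial]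
  have : ((n - 1 : ℕ) : ℝ) + 1 = n := by
    rw [Nat.cast_sub (by omega)]; simp
  rw [this, cgK]

instance cg_probS (n : ℕ) : IsProbabilityMeasure (sphereUniform n) := by
  unfold sphereUniform
  exact Measure.isProbabilityMeasure_map (by fun_prop)

lemma cg_sphere_norm (n : ℕ) (hn : 3 ≤ n) : ∀ᵐ x ∂(sphereUniform n), ‖x‖ = 1 := by
  have hm : MeasurableSet {x : EuclideanSpace ℝ (Fin n) | ‖x‖ = 1} :=
    measurableSet_eq_fun (by fun_prop) (by fun_prop)
  rw [sphereUniform, ae_map_iff (by fun_prop) hm]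
  have : Nonempty (Fin n) := ⟨⟨0, by omega⟩⟩
  have h0 : ∀ᵐ x ∂(volume : Measure (EuclideanSpace ℝ (Fin n))), x ≠ 0 := by
    rw [ae_iff]; simp
  have h1 : ∀ᵐ x ∂(stdGaussian n), x ≠ 0 := (withDensity_absolutelyContinuous _ _) h0
  filter_upwards [h1] with x hx
  have : ‖x‖ ≠ 0 := norm_ne_zero_iff.mpr hx
  simp [norm_smul, this]

lemma cg_polar (n : ℕ) (hn : 3 ≤ n) (f : EuclideanSpace ℝ (Fin n) → ENNReal) (hf : Measurable f) :
    ∫⁻ x, f x = ENNReal.ofReal (cgK n)⁻¹ * ∫⁻ θ, (∫⁻ r in Set.Ioi (0:ℝ), ENNReal.ofReal (r ^ (n - 1)) * f (r • θ))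
      ∂(sphereUniform n) := by
  have hK := cgK_pos n hn
  rw [cg_polar0 n hn f hf, cg_sphere n hn (fun θ => ∫⁻ r in Set.Ioi (0:ℝ), ENNReal.ofReal (r ^ (n - 1)) * f (r • θ))]
  · rw [← mul_assoc, ← ENNReal.ofReal_mul (by positivity), inv_mul_cancel₀ hK.ne']
    simp
  · exact Measurable.lintegral_prod_right' (f := fun p : EuclideanSpace ℝ (Fin n) × ℝ => ENNReal.ofReal (p.2 ^ (n - 1)) * f (p.2 • p.1)) (by fun_prop)

lemma cg_inv_sq (n : ℕ) (hn : 3 ≤ n) :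
    ∫⁻ x, ENNReal.ofReal ((‖x‖ ^ 2)⁻¹) ∂(stdGaussian n) < ⊤ := by
  rw [cg_lintegral_gauss _ _ (by fun_prop), cg_polar n hn _ (by fun_prop)]
  refine ENNReal.mul_lt_top (by simp) ?_
  have : ∀ᵐ θ ∂(sphereUniform n), (∫⁻ r in Set.Ioi (0:ℝ), ENNReal.ofReal (r ^ (n - 1)) *
        (ENNReal.ofReal ((2 * π) ^ (-(n:ℝ) / 2) * rexp (-‖r • θ‖ ^ 2 / 2)) * ENNReal.ofReal (‖r • θ‖ ^ 2)⁻¹)) =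
        ENNReal.ofReal ((2 * π) ^ (-(n : ℝ) / 2) * (2 ^ ((((n-3:ℕ):ℝ) + 1) / 2 - 1) * Real.Gamma ((((n-3:ℕ):ℝ) + 1) / 2))) := by
    filter_upwards [cg_sphere_norm n hn] with θ hθ
    rw [← cg_radial]
    refine setLIntegral_congr_fun measurableSet_Ioi fun r hr => ?_
    have hr0 : (0:ℝ) < r := hr
    simp only [norm_smul, hθ, mul_one, Real.norm_of_nonneg hr0.le]
    rw [mul_left_comm, mul_comm, ← ENNReal.ofReal_mul (by positivity)]
    congr 2
    obtain ⟨m, rfl⟩ := Nat.exists_eq_add_of_le hn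
    rw [show 3 + m - 1 = m + 2 by omega, show 3 + m - 3 = m by omega, pow_add]
    field_simp
  rw [lintegral_congr_ae this]
  simp

lemma cg_integral_gauss (n : ℕ) (f : EuclideanSpace ℝ (Fin n) → ℝ) :
    ∫ x, f x ∂(stdGaussian n) =
      ∫ x, ((2 * π) ^ (-(n : ℝ) / 2) * Real.exp (-‖x‖ ^ 2 / 2)) * f x := by
  rw [stdGaussian_eq, integral_withDensity_eq_integral_toReal_smul (by fun_prop) (by simp)]
  refine integral_congr_ae (Filter.Eventually.of_forall fun x => ?_)
  simp only [smul_eq_mul]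
  rw [ENNReal.toReal_ofReal (by positivity)]

lemma cg_integrable_exp4 (n : ℕ) :
    Integrable (fun x : EuclideanSpace ℝ (Fin n) => Real.exp (-‖x‖ ^ 2 / 4)) := by
  have := GaussianFourier.integrable_cexp_neg_mul_sq_norm_add (V := EuclideanSpace ℝ (Fin n))
    (b := 1/4) (by norm_num) 0 0
  have h2 := this.norm
  refine h2.congr (Filter.Eventually.of_forall fun x => ?_)
  simp only [Complex.norm_exp]
  congr 1
  simp
  norm_cast
  ring

lemma cg_integrable_norm_exp (n : ℕ) :
    Integrable (fun x : EuclideanSpace ℝ (Fin n) => ‖x‖ * Real.exp (-‖x‖ ^ 2 / 2)) := by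
  refine (cg_integrable_exp4 n).mono' (by fun_prop) (Filter.Eventually.of_forall fun x => ?_)
  rw [Real.norm_of_nonneg (by positivity)]
  have h1 : ‖x‖ ≤ Real.exp (‖x‖^2/4) := by
    nlinarith [Real.add_one_le_exp (‖x‖^2/4), sq_nonneg (‖x‖ - 2)]
  calc ‖x‖ * Real.exp (-‖x‖ ^ 2 / 2) ≤ Real.exp (‖x‖^2/4) * Real.exp (-‖x‖ ^ 2 / 2) := by gcongr
    _ = _ := by rw [← Real.exp_add]; ring_nf

lemma cg_integrable_norm (n : ℕ) : Integrable (fun x => ‖x‖) (stdGaussian n) := by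
  rw [stdGaussian_eq, integrable_withDensity_iff_integrable_smul' (by fun_prop) (by simp)]
  refine ((cg_integrable_norm_exp n).const_mul ((2 * π) ^ (-(n : ℝ) / 2))).congr
    (Filter.Eventually.of_forall fun x => ?_)
  simp only [smul_eq_mul]
  rw [ENNReal.toReal_ofReal (by positivity)]
  ring

lemma cg_measurable_gradient (n : ℕ) (f : EuclideanSpace ℝ (Fin n) → ℝ) :
    Measurable (gradient f) := by
  have : Measurable (fderiv ℝ f) := measurable_fderiv ℝ f
  exact ((InnerProductSpace.toDual ℝ (EuclideanSpace ℝ (Fin n))).symm.continuous.measurable).comp this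

lemma cg_fderiv_eq (n : ℕ) (f : EuclideanSpace ℝ (Fin n) → ℝ) (x y : EuclideanSpace ℝ (Fin n)) :
    fderiv ℝ f x y = ⟪gradient f x, y⟫ := by
  rw [gradient, InnerProductSpace.toDual_symm_apply]

lemma cg_norm_gradient (n : ℕ) (f : EuclideanSpace ℝ (Fin n) → ℝ) (x : EuclideanSpace ℝ (Fin n)) :
    ‖gradient f x‖ = ‖fderiv ℝ f x‖ := by
  rw [gradient, LinearIsometryEquiv.norm_map]

lemma cg_stein (n : ℕ) (h : EuclideanSpace ℝ (Fin n) → ℝ) (hd : Differentiable ℝ h) (M C : ℝ)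
    (hM : ∀ x, |h x| ≤ M) (hC : ∀ x, ‖gradient h x‖ ≤ C) (a : EuclideanSpace ℝ (Fin n)) :
    ∫ y, h y * ⟪a, y⟫ ∂(stdGaussian n) = ∫ y, ⟪gradient h y, a⟫ ∂(stdGaussian n) := by
  have hmg := cg_measurable_gradient n h
  have hmh : Measurable h := hd.continuous.measurable
  have hM0 : 0 ≤ M := (abs_nonneg _).trans (hM 0)
  have hC0 : 0 ≤ C := (norm_nonneg _).trans (hC 0)
  set g : EuclideanSpace ℝ (Fin n) → ℝ := fun y => Real.exp (-‖y‖ ^ 2 / 2) with hg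
  have hgd : ∀ y, HasFDerivAt g (-(g y) • innerSL ℝ y) y := by
    intro y
    have h1 := (hasStrictFDerivAt_norm_sq y).hasFDerivAt
    have h2 := ((h1.const_mul (-1/2)).exp)
    have e : g = fun x => Real.exp (-1/2 * ‖x‖^2) := by
      ext x; simp only [hg]; congr 1; ring
    rw [e]
    refine h2.congr_fderiv ?_
    ext z
    simp
    ring
  have hgf : ∀ y, fderiv ℝ g y a = - (g y * ⟪a, y⟫) := by
    intro y
    rw [(hgd y).fderiv]
    simp [real_inner_comm]
  have key := integral_mul_fderiv_eq_neg_fderiv_mul_of_integrable (μ := volume) (f := h) (g := g) (v := a) ?_ ?_ ?_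
    (fun y _ => hd y) (fun y _ => (hgd y).differentiableAt)
  · simp_rw [hgf, cg_fderiv_eq] at key
    rw [cg_integral_gauss, cg_integral_gauss]
    simp only [mul_assoc]
    rw [integral_const_mul, integral_const_mul]
    congr 1
    have k2 : ∫ y, h y * -(g y * ⟪a, y⟫) = - ∫ y, g y * (h y * ⟪a, y⟫) := by
      rw [← integral_neg]; congr 1; ext y; ring
    have k3 : ∫ y, ⟪gradient h y, a⟫ * g y = ∫ y, g y * ⟪gradient h y, a⟫ := by
      congr 1; ext y; ring
    rw [k2, k3] at key
    linarith
  · simp_rw [cg_fderiv_eq]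
    refine ((cg_integrable_exp n).const_mul (C * ‖a‖)).mono' (by fun_prop)
      (Filter.Eventually.of_forall fun x => ?_)
    rw [norm_mul, Real.norm_of_nonneg (show 0 ≤ g x by positivity)]
    gcongr
    exact (norm_inner_le_norm _ _).trans (by gcongr; exact hC x)
  · simp_rw [hgf]
    refine ((cg_integrable_norm_exp n).const_mul (M * ‖a‖)).mono' (by fun_prop)
      (Filter.Eventually.of_forall fun x => ?_)
    rw [norm_mul, norm_neg, norm_mul, Real.norm_of_nonneg (show 0 ≤ g x by positivity)]
    have e1 : ‖h x‖ ≤ M := hM x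
    have e2 : ‖⟪a, x⟫‖ ≤ ‖a‖ * ‖x‖ := norm_inner_le_norm _ _
    calc ‖h x‖ * (g x * ‖⟪a, x⟫‖) ≤ M * (g x * (‖a‖ * ‖x‖)) := by gcongr
      _ = _ := by rw [hg]; ring
  · refine ((cg_integrable_exp n).const_mul M).mono' (by fun_prop)
      (Filter.Eventually.of_forall fun x => ?_)
    rw [norm_mul, Real.norm_of_nonneg (show 0 ≤ g x by positivity)]
    gcongr
    exact hM x

/-- Rotation on pairs. -/
noncomputable def cgR (n : ℕ) (s : ℝ) (p : EuclideanSpace ℝ (Fin n) × EuclideanSpace ℝ (Fin n)) :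
    EuclideanSpace ℝ (Fin n) × EuclideanSpace ℝ (Fin n) :=
  (Real.cos s • p.1 + Real.sin s • p.2, -Real.sin s • p.1 + Real.cos s • p.2)

lemma cgR_inv (n : ℕ) (s : ℝ) (p : EuclideanSpace ℝ (Fin n) × EuclideanSpace ℝ (Fin n)) :
    cgR n (-s) (cgR n s p) = p := by
  have h := Real.sin_sq_add_cos_sq s
  ext i
  · simp [cgR]
    linear_combination (p.1 i) * h
  · simp [cgR]
    linear_combination (p.2 i) * h

lemma cgR_norm (n : ℕ) (s : ℝ) (p : EuclideanSpace ℝ (Fin n) × EuclideanSpace ℝ (Fin n)) :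
    ‖(cgR n s p).1‖ ^ 2 + ‖(cgR n s p).2‖ ^ 2 = ‖p.1‖ ^ 2 + ‖p.2‖ ^ 2 := by
  have h := Real.sin_sq_add_cos_sq s
  simp only [cgR]
  rw [norm_add_sq_real, norm_add_sq_real]
  simp only [norm_smul, inner_smul_left, inner_smul_right, mul_pow, Real.norm_eq_abs, sq_abs,
    RCLike.conj_to_real]
  linear_combination (‖p.1‖ ^ 2 + ‖p.2‖ ^ 2) * h

/-- Rotation as a linear isometry. -/
noncomputable def cgRI (n : ℕ) (s : ℝ) : WithLp 2 (EuclideanSpace ℝ (Fin n) × EuclideanSpace ℝ (Fin n)) ≃ₗᵢ[ℝ]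
    WithLp 2 (EuclideanSpace ℝ (Fin n) × EuclideanSpace ℝ (Fin n)) where
  toFun p := WithLp.toLp 2 (cgR n s (WithLp.ofLp p))
  invFun p := WithLp.toLp 2 (cgR n (-s) (WithLp.ofLp p))
  left_inv p := by
    simp [cgR_inv]
  right_inv p := by
    have := cgR_inv n (-s) (WithLp.ofLp p)
    rw [neg_neg] at this
    simp [this]
  map_add' p q := by
    apply (WithLp.equiv 2 _).injective
    ext i <;> simp [cgR] <;> ring
  map_smul' c p := by
    apply (WithLp.equiv 2 _).injective
    ext i <;> simp [cgR] <;> ring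
  norm_map' p := by
    have := cgR_norm n s (WithLp.ofLp p)
    rw [← sq_eq_sq₀ (norm_nonneg _) (norm_nonneg _), WithLp.prod_norm_sq_eq_of_L2, WithLp.prod_norm_sq_eq_of_L2]
    exact this

lemma cgR_vol (n : ℕ) (s : ℝ) : MeasurePreserving (cgR n s) (volume.prod volume) (volume.prod volume) := by
  have h1 := WithLp.volume_preserving_toLp (EuclideanSpace ℝ (Fin n)) (EuclideanSpace ℝ (Fin n))
  have h2 := (cgRI n s).measurePreserving
  have h3 := WithLp.volume_preserving_ofLp (EuclideanSpace ℝ (Fin n)) (EuclideanSpace ℝ (Fin n))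
  exact h3.comp (h2.comp h1)

lemma cg_prod_eq (n : ℕ) : (stdGaussian n).prod (stdGaussian n) = (volume.prod volume).withDensity
    (fun p => ENNReal.ofReal (((2 * π) ^ (-(n : ℝ) / 2)) ^ 2 * Real.exp (-(‖p.1‖ ^ 2 + ‖p.2‖ ^ 2) / 2))) := by
  rw [stdGaussian_eq, prod_withDensity (by fun_prop) (by fun_prop)]
  congr 1
  ext p
  rw [← ENNReal.ofReal_mul (by positivity)]
  congr 1
  rw [show -(‖p.1‖ ^ 2 + ‖p.2‖ ^ 2) / 2 = -‖p.1‖ ^ 2 / 2 + -‖p.2‖ ^ 2 / 2 by ring, Real.exp_add]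
  ring

lemma cgR_gauss (n : ℕ) (s : ℝ) : MeasurePreserving (cgR n s) ((stdGaussian n).prod (stdGaussian n))
    ((stdGaussian n).prod (stdGaussian n)) := by
  have hm : Measurable (cgR n s) := (cgR_vol n s).measurable
  refine ⟨hm, ?_⟩
  rw [cg_prod_eq]
  ext A hA
  rw [Measure.map_apply hm hA, withDensity_apply _ (hm hA), withDensity_apply _ hA,
    ← (cgR_vol n s).setLIntegral_comp_preimage hA (by fun_prop)]
  simp_rw [cgR_norm]

lemma cg_cov_smooth (n : ℕ) (f g : EuclideanSpace ℝ (Fin n) → ℝ)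
    (hf : Differentiable ℝ f) (hg : Differentiable ℝ g) (M C D N : ℝ)
    (hfM : ∀ x, |f x| ≤ M) (hfC : ∀ x, ‖gradient f x‖ ≤ C)
    (hgN : ∀ x, |g x| ≤ N) (hgD : ∀ x, ‖gradient g x‖ ≤ D) :
    (∫ x, f x * g x ∂(stdGaussian n)) - (∫ x, f x ∂(stdGaussian n)) * (∫ x, g x ∂(stdGaussian n)) =
    ∫ q, Real.sin q.1 * ⟪gradient f (Real.cos q.1 • q.2.1 - Real.sin q.1 • q.2.2), gradient g q.2.1⟫
      ∂((volume.restrict (Set.Ioo (0:ℝ) (π/2))).prod ((stdGaussian n).prod (stdGaussian n))) := by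
  have hM0 : 0 ≤ M := (abs_nonneg _).trans (hfM 0)
  have hC0 : 0 ≤ C := (norm_nonneg _).trans (hfC 0)
  have hD0 : 0 ≤ D := (norm_nonneg _).trans (hgD 0)
  have hmf : Measurable f := hf.continuous.measurable
  have hmg : Measurable g := hg.continuous.measurable
  have hmgf := cg_measurable_gradient n f
  have hmgg := cg_measurable_gradient n g
  set γ := stdGaussian n with hγ
  have hpi : (0:ℝ) ≤ π / 2 := by positivity
  have hin : Integrable (fun p : EuclideanSpace ℝ (Fin n) × EuclideanSpace ℝ (Fin n) => ‖p.1‖ + ‖p.2‖) (γ.prod γ) :=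
    ((cg_integrable_norm n).comp_fst _).add ((cg_integrable_norm n).comp_snd _)
  have hfi : Integrable f γ := Integrable.of_bound (by fun_prop) M (Filter.Eventually.of_forall hfM)
  have hgi : Integrable g γ := Integrable.of_bound (by fun_prop) N (Filter.Eventually.of_forall hgN)
  have hfgi : Integrable (fun x => f x * g x) γ := hfi.mul_bdd (c := N) (by fun_prop) (Filter.Eventually.of_forall hgN)
  -- step 1
  have s1 : (∫ x, f x * g x ∂γ) - (∫ x, f x ∂γ) * (∫ x, g x ∂γ) =
      - ∫ p, f p.1 * (g p.2 - g p.1) ∂(γ.prod γ) := by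
    have a1 : ∫ p, f p.1 * (g p.2 - g p.1) ∂(γ.prod γ) =
        ∫ p, f p.1 * g p.2 ∂(γ.prod γ) - ∫ p, (fun x => f x * g x) p.1 ∂(γ.prod γ) := by
      rw [← integral_sub (hfi.mul_prod hgi) (hfgi.comp_fst _)]
      congr 1; ext p; ring
    rw [a1, integral_prod_mul, integral_fun_fst (fun x => f x * g x)]
    simp
  -- step 2
  have s2 : ∀ p : EuclideanSpace ℝ (Fin n) × EuclideanSpace ℝ (Fin n),
      f p.1 * (g p.2 - g p.1) = ∫ s in Set.Ioo (0:ℝ) (π/2), f p.1 * ⟪gradient g (cgR n s p).1, (cgR n s p).2⟫ := by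
    intro p
    rw [integral_const_mul]
    congr 1
    have hd : ∀ s ∈ Set.uIcc (0:ℝ) (π/2), HasDerivAt (fun s => g (cgR n s p).1) ⟪gradient g (cgR n s p).1, (cgR n s p).2⟫ s := by
      intro s _
      have h1 : HasDerivAt (fun s => (cgR n s p).1) (cgR n s p).2 s := by
        exact ((Real.hasDerivAt_cos s).smul_const p.1).add ((Real.hasDerivAt_sin s).smul_const p.2)
      have h2 := (hg (cgR n s p).1).hasFDerivAt.comp_hasDerivAt s h1
      rw [cg_fderiv_eq] at h2
      exact h2
    have hint : IntervalIntegrable (fun s => ⟪gradient g (cgR n s p).1, (cgR n s p).2⟫) volume 0 (π/2) := by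
      rw [intervalIntegrable_iff_integrableOn_Ioo_of_le hpi]
      refine Integrable.of_bound (C := D * (‖p.1‖ + ‖p.2‖)) ?_ (Filter.Eventually.of_forall fun s => ?_)
      · unfold cgR
        fun_prop
      · refine (norm_inner_le_norm _ _).trans ?_
        gcongr
        · exact hgD _
        · refine (norm_add_le _ _).trans ?_
          rw [norm_smul, norm_smul]
          have c1 : ‖-Real.sin s‖ ≤ 1 := by rw [norm_neg]; exact Real.abs_sin_le_one s
          have c2 : ‖Real.cos s‖ ≤ 1 := Real.abs_cos_le_one s
          gcongr
          · exact mul_le_of_le_one_left (norm_nonneg _) c1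
          · exact mul_le_of_le_one_left (norm_nonneg _) c2
    have := intervalIntegral.integral_eq_sub_of_hasDerivAt hd hint
    rw [intervalIntegral.integral_of_le hpi, integral_Ioc_eq_integral_Ioo] at this
    rw [this]
    simp [cgR]
  -- step 3
  have hbd : ∀ s : ℝ, ∀ p, ‖f p.1 * ⟪gradient g (cgR n s p).1, (cgR n s p).2⟫‖ ≤ M * (D * (‖p.1‖ + ‖p.2‖)) := by
    intro s p
    rw [norm_mul]
    have : ‖f p.1‖ ≤ M := hfM _
    gcongr
    refine (norm_inner_le_norm _ _).trans ?_
    gcongr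
    · exact hgD _
    · refine (norm_add_le _ _).trans ?_
      rw [norm_smul, norm_smul]
      have c1 : ‖-Real.sin s‖ ≤ 1 := by rw [norm_neg]; exact Real.abs_sin_le_one s
      have c2 : ‖Real.cos s‖ ≤ 1 := Real.abs_cos_le_one s
      gcongr
      · exact mul_le_of_le_one_left (norm_nonneg _) c1
      · exact mul_le_of_le_one_left (norm_nonneg _) c2
  have s3 : ∫ p, f p.1 * (g p.2 - g p.1) ∂(γ.prod γ) =
      ∫ s in Set.Ioo (0:ℝ) (π/2), ∫ p, f p.1 * ⟪gradient g (cgR n s p).1, (cgR n s p).2⟫ ∂(γ.prod γ) := by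
    simp_rw [s2]
    rw [integral_integral_swap]
    refine (((hin.const_mul D).const_mul M).comp_fst (volume.restrict (Set.Ioo (0:ℝ) (π/2)))).mono' ?_
      (Filter.Eventually.of_forall fun q => hbd q.2 q.1)
    simp only [Function.uncurry_def, cgR]
    fun_prop
  -- step 4
  have s4 : ∀ s : ℝ, ∫ p, f p.1 * ⟪gradient g (cgR n s p).1, (cgR n s p).2⟫ ∂(γ.prod γ)
      = - ∫ p, Real.sin s * ⟪gradient f (Real.cos s • p.1 - Real.sin s • p.2), gradient g p.1⟫ ∂(γ.prod γ) := by
    intro s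
    have hR := cgR_gauss n s
    have b0 : AEStronglyMeasurable (fun q : EuclideanSpace ℝ (Fin n) × EuclideanSpace ℝ (Fin n) =>
        f (Real.cos s • q.1 - Real.sin s • q.2) * ⟪gradient g q.1, q.2⟫) (γ.prod γ) := by fun_prop
    have b1 : ∫ p, f p.1 * ⟪gradient g (cgR n s p).1, (cgR n s p).2⟫ ∂(γ.prod γ) =
        ∫ q, f (Real.cos s • q.1 - Real.sin s • q.2) * ⟪gradient g q.1, q.2⟫ ∂(γ.prod γ) := by
      have : ∫ q, f (Real.cos s • q.1 - Real.sin s • q.2) * ⟪gradient g q.1, q.2⟫ ∂(γ.prod γ) =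
         ∫ q, f (Real.cos s • q.1 - Real.sin s • q.2) * ⟪gradient g q.1, q.2⟫ ∂((γ.prod γ).map (cgR n s)) := by
        rw [hR.map_eq]
      rw [this, integral_map hR.measurable.aemeasurable (by rw [hR.map_eq]; exact b0)]
      congr 1
      ext p
      have e : Real.cos s • (cgR n s p).1 - Real.sin s • (cgR n s p).2 = p.1 := by
        have := congrArg Prod.fst (cgR_inv n s p)
        rw [← this]
        simp [cgR, sub_eq_add_neg]
        abel
      rw [e]
    have i1 : Integrable (fun q : EuclideanSpace ℝ (Fin n) × EuclideanSpace ℝ (Fin n) =>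
        f (Real.cos s • q.1 - Real.sin s • q.2) * ⟪gradient g q.1, q.2⟫) (γ.prod γ) := by
      refine ((hin.const_mul D).const_mul M).mono' b0 (Filter.Eventually.of_forall fun q => ?_)
      rw [norm_mul]
      have : ‖f (Real.cos s • q.1 - Real.sin s • q.2)‖ ≤ M := hfM _
      gcongr
      refine (norm_inner_le_norm _ _).trans ?_
      gcongr
      · exact hgD _
      · linarith [norm_nonneg q.1]
    have i2 : Integrable (fun p : EuclideanSpace ℝ (Fin n) × EuclideanSpace ℝ (Fin n) =>
        Real.sin s * ⟪gradient f (Real.cos s • p.1 - Real.sin s • p.2), gradient g p.1⟫) (γ.prod γ) := by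
      refine Integrable.of_bound (C := 1 * (C * D)) (by fun_prop) (Filter.Eventually.of_forall fun q => ?_)
      rw [norm_mul]
      gcongr
      · exact Real.abs_sin_le_one s
      · refine (norm_inner_le_norm _ _).trans ?_
        gcongr
        · exact hfC _
        · exact hgD _
    rw [b1, integral_prod _ i1, integral_prod _ i2, ← integral_neg]
    congr 1
    ext x
    have hd : ∀ y, HasFDerivAt (fun y => f (Real.cos s • x - Real.sin s • y))
        (-(Real.sin s) • fderiv ℝ f (Real.cos s • x - Real.sin s • y)) y := by
      intro y
      have h1 : HasFDerivAt (fun y : EuclideanSpace ℝ (Fin n) => Real.cos s • x - Real.sin s • y)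
        (-(Real.sin s • ContinuousLinearMap.id ℝ _)) y := by
        exact ((hasFDerivAt_id y).const_smul (Real.sin s)).const_sub (Real.cos s • x)
      have h2 := (hf (Real.cos s • x - Real.sin s • y)).hasFDerivAt.comp y h1
      refine h2.congr_fderiv ?_
      ext z
      simp
    have hgr : ∀ y, gradient (fun y => f (Real.cos s • x - Real.sin s • y)) y =
        -(Real.sin s) • gradient f (Real.cos s • x - Real.sin s • y) := by
      intro y
      rw [gradient, (hd y).fderiv, gradient]
      simp
    have st := cg_stein n (fun y => f (Real.cos s • x - Real.sin s • y)) (fun y => (hd y).differentiableAt)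
      M C (fun y => hfM _) (fun y => by
        rw [hgr, norm_smul, norm_neg]
        calc _ ≤ 1 * C := by
              gcongr
              · exact Real.abs_sin_le_one s
              · exact hfC _
          _ = C := one_mul _) (gradient g x)
    rw [st, ← integral_neg]
    congr 1
    ext y
    rw [hgr, inner_smul_left]
    simp
  rw [s1, s3]
  simp_rw [s4]
  rw [integral_neg, neg_neg]
  symm
  apply integral_prod
  refine Integrable.of_bound (C := 1 * (C * D)) (by fun_prop) (Filter.Eventually.of_forall fun q => ?_)
  rw [norm_mul]
  gcongr
  · exact Real.abs_sin_le_one _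
  · refine (norm_inner_le_norm _ _).trans ?_
    gcongr
    · exact hfC _
    · exact hgD _

/-- The time-Gaussian-Gaussian measure. -/
noncomputable def cgmu (n : ℕ) : Measure (ℝ × (EuclideanSpace ℝ (Fin n) × EuclideanSpace ℝ (Fin n))) :=
  (volume.restrict (Set.Ioo (0:ℝ) (π/2))).prod ((stdGaussian n).prod (stdGaussian n))

/-- The rotated first coordinate. -/
noncomputable def cgT (n : ℕ) (q : ℝ × (EuclideanSpace ℝ (Fin n) × EuclideanSpace ℝ (Fin n))) :
    EuclideanSpace ℝ (Fin n) := Real.cos q.1 • q.2.1 - Real.sin q.1 • q.2.2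

lemma cgT_meas (n : ℕ) : Measurable (cgT n) := by unfold cgT; fun_prop

lemma cg_skew (n : ℕ) : MeasurePreserving (fun q : ℝ × (EuclideanSpace ℝ (Fin n) × EuclideanSpace ℝ (Fin n)) =>
    (q.1, cgR n (-q.1) q.2)) (cgmu n) (cgmu n) := by
  refine MeasurePreserving.skew_product (MeasurePreserving.id _) (g := fun s p => cgR n (-s) p) ?_
    (Filter.Eventually.of_forall fun s => (cgR_gauss n (-s)).map_eq)
  simp only [Function.uncurry_def, cgR]
  fun_prop

lemma cgT_eq (n : ℕ) (q : ℝ × (EuclideanSpace ℝ (Fin n) × EuclideanSpace ℝ (Fin n))) :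
    cgT n q = (cgR n (-q.1) q.2).1 := by
  simp [cgT, cgR, sub_eq_add_neg]

lemma cg_gauss_ne (n : ℕ) (hn : 3 ≤ n) : ∀ᵐ x ∂(stdGaussian n), x ≠ 0 := by
  have : Nonempty (Fin n) := ⟨⟨0, by omega⟩⟩
  have h0 : ∀ᵐ x ∂(volume : Measure (EuclideanSpace ℝ (Fin n))), x ≠ 0 := by
    rw [ae_iff]; simp
  exact (withDensity_absolutelyContinuous _ _) h0

lemma cg_X_ne (n : ℕ) (hn : 3 ≤ n) : ∀ᵐ q ∂(cgmu n), q.2.1 ≠ 0 := by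
  have h1 := (Measure.quasiMeasurePreserving_fst (μ := stdGaussian n) (ν := stdGaussian n)).ae (cg_gauss_ne n hn)
  exact (Measure.quasiMeasurePreserving_snd (μ := volume.restrict (Set.Ioo (0:ℝ) (π/2)))
    (ν := (stdGaussian n).prod (stdGaussian n))).ae h1

lemma cg_T_ne (n : ℕ) (hn : 3 ≤ n) : ∀ᵐ q ∂(cgmu n), cgT n q ≠ 0 := by
  have := (cg_skew n).quasiMeasurePreserving.ae (cg_X_ne n hn)
  filter_upwards [this] with q hq
  rw [cgT_eq]
  exact hq

lemma cg_J_integrable (n : ℕ) (hn : 3 ≤ n) :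
    Integrable (fun q => (‖cgT n q‖ * ‖q.2.1‖)⁻¹) (cgmu n) := by
  have h0 : Integrable (fun x => (‖x‖ ^ 2)⁻¹) (stdGaussian n) := by
    refine ⟨by fun_prop, ?_⟩
    rw [hasFiniteIntegral_iff_ofReal (Filter.Eventually.of_forall fun x => by positivity)]
    exact cg_inv_sq n hn
  have h1 : Integrable (fun q : ℝ × (EuclideanSpace ℝ (Fin n) × EuclideanSpace ℝ (Fin n)) => (‖q.2.1‖ ^ 2)⁻¹) (cgmu n) :=
    (h0.comp_fst (stdGaussian n)).comp_snd (volume.restrict (Set.Ioo (0:ℝ) (π/2)))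
  have h2 : Integrable (fun q => (‖cgT n q‖ ^ 2)⁻¹) (cgmu n) := by
    have := (cg_skew n).integrable_comp_of_integrable h1
    refine this.congr (Filter.Eventually.of_forall fun q => ?_)
    simp [cgT_eq]
  have hT := cgT_meas n
  refine (h1.add h2).mono' (by fun_prop) (Filter.Eventually.of_forall fun q => ?_)
  rw [Real.norm_of_nonneg (by positivity), mul_inv]
  simp only [Pi.add_apply, ← inv_pow]
  nlinarith [sq_nonneg (‖cgT n q‖⁻¹ - ‖q.2.1‖⁻¹), sq_nonneg (‖cgT n q‖⁻¹), sq_nonneg (‖q.2.1‖⁻¹)]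

/-- Cut-off regularisation. -/
noncomputable def cgA (n : ℕ) (u : EuclideanSpace ℝ (Fin n) → ℝ) (ε : ℝ) (x : EuclideanSpace ℝ (Fin n)) : ℝ :=
  (‖x‖ ^ 2 / (‖x‖ ^ 2 + ε)) * u x

lemma cgA_bound (n : ℕ) (u : EuclideanSpace ℝ (Fin n) → ℝ) (ε : ℝ) (hε : 0 < ε) (M : ℝ) (hM : ∀ x, |u x| ≤ M)
    (x : EuclideanSpace ℝ (Fin n)) : |cgA n u ε x| ≤ M := by
  have hM0 : 0 ≤ M := (abs_nonneg _).trans (hM 0)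
  rw [cgA, abs_mul, abs_of_nonneg (by positivity)]
  calc _ ≤ 1 * M := by
        gcongr
        · rw [div_le_one (by positivity)]; linarith
        · exact hM x
    _ = M := one_mul M

lemma cgA_diff0 (n : ℕ) (u : EuclideanSpace ℝ (Fin n) → ℝ) (ε : ℝ) (hε : 0 < ε) (M : ℝ) (hM : ∀ x, |u x| ≤ M) :
    HasFDerivAt (cgA n u ε) (0 : EuclideanSpace ℝ (Fin n) →L[ℝ] ℝ) 0 := by
  have hM0 : 0 ≤ M := (abs_nonneg _).trans (hM 0)
  have : (cgA n u ε) =O[nhds 0] fun x => ‖x - 0‖ ^ 2 := by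
    refine Asymptotics.IsBigO.of_bound (M / ε) (Filter.Eventually.of_forall fun x => ?_)
    rw [cgA, norm_mul, Real.norm_of_nonneg (by positivity : 0 ≤ ‖x‖ ^ 2 / (‖x‖ ^ 2 + ε)), sub_zero,
      Real.norm_of_nonneg (by positivity : 0 ≤ ‖x‖ ^ 2)]
    have : ‖u x‖ ≤ M := hM x
    calc ‖x‖ ^ 2 / (‖x‖ ^ 2 + ε) * ‖u x‖ ≤ ‖x‖ ^ 2 / ε * M := by
          gcongr
          nlinarith [sq_nonneg ‖x‖]
      _ = _ := by ring
  exact this.hasFDerivAt (by norm_num)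

lemma cgA_fderiv (n : ℕ) (u : EuclideanSpace ℝ (Fin n) → ℝ) (ε : ℝ) (hε : 0 < ε)
    (x : EuclideanSpace ℝ (Fin n)) (hd : DifferentiableAt ℝ u x) :
    HasFDerivAt (cgA n u ε) ((‖x‖ ^ 2 / (‖x‖ ^ 2 + ε)) • fderiv ℝ u x +
      (u x * (2 * ε / (‖x‖ ^ 2 + ε) ^ 2)) • innerSL ℝ x) x := by
  have h1 := (hasStrictFDerivAt_norm_sq x).hasFDerivAt
  have hne : ‖x‖ ^ 2 + ε ≠ 0 := by positivity
  have h2 : HasDerivAt (fun t : ℝ => t / (t + ε)) (ε / (‖x‖ ^ 2 + ε) ^ 2) (‖x‖ ^ 2) := by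
    have := (hasDerivAt_id (‖x‖ ^ 2)).div ((hasDerivAt_id (‖x‖ ^ 2)).add_const ε) hne
    refine this.congr_deriv ?_
    simp
  have h3 := h2.comp_hasFDerivAt x h1
  have h4 := h3.mul hd.hasFDerivAt
  refine h4.congr_fderiv ?_
  ext z
  simp
  ring

lemma cgA_grad (n : ℕ) (u : EuclideanSpace ℝ (Fin n) → ℝ) (ε : ℝ) (hε : 0 < ε)
    (x : EuclideanSpace ℝ (Fin n)) (hd : DifferentiableAt ℝ u x) :
    gradient (cgA n u ε) x = (‖x‖ ^ 2 / (‖x‖ ^ 2 + ε)) • gradient u x +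
      (u x * (2 * ε / (‖x‖ ^ 2 + ε) ^ 2)) • x := by
  rw [gradient, (cgA_fderiv n u ε hε x hd).fderiv, gradient, map_add, map_smulₛₗ, map_smulₛₗ]
  congr 2
  rw [LinearIsometryEquiv.symm_apply_eq]
  ext z
  simp

lemma cgA_grad_bound (n : ℕ) (u : EuclideanSpace ℝ (Fin n) → ℝ) (ε : ℝ) (hε : 0 < ε) (M C : ℝ)
    (hM : ∀ x, |u x| ≤ M)
    (x : EuclideanSpace ℝ (Fin n)) (hx : x ≠ 0) (hd : DifferentiableAt ℝ u x) (hC0 : 0 ≤ C)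
    (hC : ‖gradient u x‖ ≤ C * ‖x‖⁻¹) :
    ‖gradient (cgA n u ε) x‖ ≤ (C + 2 * M) * (‖x‖ / (‖x‖ ^ 2 + ε)) := by
  have hM0 : 0 ≤ M := (abs_nonneg _).trans (hM 0)
  have hx0 : 0 < ‖x‖ := norm_pos_iff.mpr hx
  rw [cgA_grad n u ε hε x hd]
  refine (norm_add_le _ _).trans ?_
  rw [norm_smul, norm_smul, norm_mul, Real.norm_of_nonneg (by positivity : 0 ≤ ‖x‖ ^ 2 / (‖x‖ ^ 2 + ε)),
   Real.norm_of_nonneg (by positivity : 0 ≤ 2 * ε / (‖x‖ ^ 2 + ε)^2)]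
  have h1 : ‖u x‖ ≤ M := hM x
  calc _ ≤ ‖x‖ ^ 2 / (‖x‖ ^ 2 + ε) * (C * ‖x‖⁻¹) + M * (2 * ((‖x‖^2 + ε)) / (‖x‖ ^ 2 + ε) ^ 2) * ‖x‖ := by
        gcongr
        nlinarith [sq_nonneg ‖x‖]
    _ = _ := by field_simp

lemma cgA_tendsto (n : ℕ) (u : EuclideanSpace ℝ (Fin n) → ℝ) (x : EuclideanSpace ℝ (Fin n)) (hx : x ≠ 0) :
    Filter.Tendsto (fun k : ℕ => cgA n u (1 / ((k:ℝ) + 1)) x) Filter.atTop (nhds (u x)) := by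
  have hx0 : 0 < ‖x‖ := norm_pos_iff.mpr hx
  have hc : ContinuousAt (fun ε : ℝ => cgA n u ε x) 0 := by
    unfold cgA
    refine ContinuousAt.mul (ContinuousAt.div (by fun_prop) (by fun_prop) ?_) (by fun_prop)
    positivity
  have h := hc.tendsto.comp (tendsto_one_div_add_atTop_nhds_zero_nat (𝕜 := ℝ))
  have e : cgA n u 0 x = u x := by
    unfold cgA; rw [add_zero, div_self (by positivity), one_mul]
  rw [e] at h
  exact h

lemma cgA_grad_tendsto (n : ℕ) (u : EuclideanSpace ℝ (Fin n) → ℝ) (x : EuclideanSpace ℝ (Fin n)) (hx : x ≠ 0)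
    (hd : DifferentiableAt ℝ u x) :
    Filter.Tendsto (fun k : ℕ => gradient (cgA n u (1 / ((k:ℝ) + 1))) x) Filter.atTop (nhds (gradient u x)) := by
  have hx0 : 0 < ‖x‖ := norm_pos_iff.mpr hx
  have hc : ContinuousAt (fun ε : ℝ => (‖x‖ ^ 2 / (‖x‖ ^ 2 + ε)) • gradient u x +
      (u x * (2 * ε / (‖x‖ ^ 2 + ε) ^ 2)) • x) 0 := by
    have h1 : ContinuousAt (fun ε : ℝ => ‖x‖ ^ 2 / (‖x‖ ^ 2 + ε)) 0 :=
      ContinuousAt.div (by fun_prop) (by fun_prop) (by positivity)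
    have h2 : ContinuousAt (fun ε : ℝ => 2 * ε / (‖x‖ ^ 2 + ε) ^ 2) 0 :=
      ContinuousAt.div (by fun_prop) (by fun_prop) (by positivity)
    fun_prop
  have h := hc.tendsto.comp (tendsto_one_div_add_atTop_nhds_zero_nat (𝕜 := ℝ))
  have e : (‖x‖ ^ 2 / (‖x‖ ^ 2 + 0)) • gradient u x +
      (u x * (2 * 0 / (‖x‖ ^ 2 + 0) ^ 2)) • x = gradient u x := by
    rw [add_zero, div_self (by positivity)]; simp
  rw [e] at h
  refine h.congr fun k => ?_
  rw [cgA_grad n u _ (by positivity) x hd]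
  rfl

lemma cg_cov_sing (n : ℕ) (hn : 3 ≤ n) (u v : EuclideanSpace ℝ (Fin n) → ℝ)
    (hu : ∀ x, x ≠ 0 → DifferentiableAt ℝ u x) (hv : ∀ x, x ≠ 0 → DifferentiableAt ℝ v x)
    (M C N D : ℝ) (hC0 : 0 ≤ C) (hD0 : 0 ≤ D)
    (huM : ∀ x, |u x| ≤ M) (huC : ∀ x, x ≠ 0 → ‖gradient u x‖ ≤ C * ‖x‖⁻¹)
    (hvN : ∀ x, |v x| ≤ N) (hvD : ∀ x, x ≠ 0 → ‖gradient v x‖ ≤ D * ‖x‖⁻¹) :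
    (∫ x, u x * v x ∂(stdGaussian n)) - (∫ x, u x ∂(stdGaussian n)) * (∫ x, v x ∂(stdGaussian n)) =
    ∫ q, Real.sin q.1 * ⟪gradient u (cgT n q), gradient v q.2.1⟫ ∂(cgmu n) := by
  have hM0 : 0 ≤ M := (abs_nonneg _).trans (huM 0)
  have hN0 : 0 ≤ N := (abs_nonneg _).trans (hvN 0)
  have diff : ∀ (w : EuclideanSpace ℝ (Fin n) → ℝ) (K : ℝ), (∀ x, |w x| ≤ K) →
      (∀ x, x ≠ 0 → DifferentiableAt ℝ w x) → ∀ ε > 0, Differentiable ℝ (cgA n w ε) := by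
    intro w K hK hw ε hε x
    by_cases hx : x = 0
    · subst hx; exact (cgA_diff0 n w ε hε K hK).differentiableAt
    · exact (cgA_fderiv n w ε hε x (hw x hx)).differentiableAt
  have bd : ∀ (w : EuclideanSpace ℝ (Fin n) → ℝ) (K B : ℝ), (∀ x, |w x| ≤ K) → 0 ≤ B →
      (∀ x, x ≠ 0 → DifferentiableAt ℝ w x) → (∀ x, x ≠ 0 → ‖gradient w x‖ ≤ B * ‖x‖⁻¹) →
      ∀ ε > 0, ∀ x, ‖gradient (cgA n w ε) x‖ ≤ (B + 2 * K) * (1 + 1 / ε) := by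
    intro w K B hK hB hw hwB ε hε x
    have hK0 : 0 ≤ K := (abs_nonneg _).trans (hK 0)
    by_cases hx : x = 0
    · subst hx
      rw [cg_norm_gradient, (cgA_diff0 n w ε hε K hK).fderiv, norm_zero]
      positivity
    · refine (cgA_grad_bound n w ε hε K B hK x hx (hw x hx) hB (hwB x hx)).trans ?_
      gcongr
      rw [div_le_iff₀ (by positivity)]
      have : (1 + 1 / ε) * (‖x‖ ^ 2 + ε) = ‖x‖ ^ 2 + 1 + ε + ‖x‖ ^ 2 / ε := by field_simp; ring
      rw [this]
      have : 0 ≤ ‖x‖ ^ 2 / ε := by positivity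
      nlinarith [sq_nonneg (‖x‖ - 1)]
  have bd2 : ∀ (w : EuclideanSpace ℝ (Fin n) → ℝ) (K B : ℝ), (∀ x, |w x| ≤ K) → 0 ≤ B →
      (∀ x, x ≠ 0 → DifferentiableAt ℝ w x) → (∀ x, x ≠ 0 → ‖gradient w x‖ ≤ B * ‖x‖⁻¹) →
      ∀ ε > 0, ∀ x, x ≠ 0 → ‖gradient (cgA n w ε) x‖ ≤ (B + 2 * K) * ‖x‖⁻¹ := by
    intro w K B hK hB hw hwB ε hε x hx
    have hK0 : 0 ≤ K := (abs_nonneg _).trans (hK 0)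
    have hx0 : 0 < ‖x‖ := norm_pos_iff.mpr hx
    refine (cgA_grad_bound n w ε hε K B hK x hx (hw x hx) hB (hwB x hx)).trans ?_
    gcongr
    rw [div_le_iff₀ (by positivity)]
    field_simp
    linarith
  have hεk : ∀ k : ℕ, (0:ℝ) < 1 / ((k:ℝ) + 1) := fun k => by positivity
  have key := fun k : ℕ => cg_cov_smooth n (cgA n u (1 / ((k:ℝ) + 1))) (cgA n v (1 / ((k:ℝ) + 1)))
    (diff u M huM hu _ (hεk k)) (diff v N hvN hv _ (hεk k)) M _ _ N
    (cgA_bound n u _ (hεk k) M huM) (bd u M C huM hC0 hu huC _ (hεk k))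
    (cgA_bound n v _ (hεk k) N hvN) (bd v N D hvN hD0 hv hvD _ (hεk k))
  have mA : ∀ (w : EuclideanSpace ℝ (Fin n) → ℝ) (K : ℝ), (∀ x, |w x| ≤ K) →
      (∀ x, x ≠ 0 → DifferentiableAt ℝ w x) → ∀ k : ℕ, Measurable (cgA n w (1 / ((k:ℝ) + 1))) :=
    fun w K hK hw k => (diff w K hK hw _ (hεk k)).continuous.measurable
  have mu := mA u M huM hu
  have mv := mA v N hvN hv
  have hne := cg_gauss_ne n hn
  have l1 : Filter.Tendsto (fun k : ℕ => ∫ x, cgA n u (1 / ((k:ℝ) + 1)) x * cgA n v (1 / ((k:ℝ) + 1)) x ∂(stdGaussian n))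
      Filter.atTop (nhds (∫ x, u x * v x ∂(stdGaussian n))) := by
    refine tendsto_integral_of_dominated_convergence (fun _ => M * N) (fun k => ((mu k).mul (mv k)).aestronglyMeasurable)
      (integrable_const _) (fun k => Filter.Eventually.of_forall fun x => ?_) ?_
    · rw [norm_mul]
      gcongr
      · exact cgA_bound n u _ (hεk k) M huM x
      · exact cgA_bound n v _ (hεk k) N hvN x
    · filter_upwards [hne] with x hx
      exact (cgA_tendsto n u x hx).mul (cgA_tendsto n v x hx)
  have l2 : Filter.Tendsto (fun k : ℕ => ∫ x, cgA n u (1 / ((k:ℝ) + 1)) x ∂(stdGaussian n))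
      Filter.atTop (nhds (∫ x, u x ∂(stdGaussian n))) := by
    refine tendsto_integral_of_dominated_convergence (fun _ => M) (fun k => (mu k).aestronglyMeasurable)
      (integrable_const _) (fun k => Filter.Eventually.of_forall fun x => cgA_bound n u _ (hεk k) M huM x) ?_
    filter_upwards [hne] with x hx
    exact cgA_tendsto n u x hx
  have l3 : Filter.Tendsto (fun k : ℕ => ∫ x, cgA n v (1 / ((k:ℝ) + 1)) x ∂(stdGaussian n))
      Filter.atTop (nhds (∫ x, v x ∂(stdGaussian n))) := by
    refine tendsto_integral_of_dominated_convergence (fun _ => N) (fun k => (mv k).aestronglyMeasurable)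
      (integrable_const _) (fun k => Filter.Eventually.of_forall fun x => cgA_bound n v _ (hεk k) N hvN x) ?_
    filter_upwards [hne] with x hx
    exact cgA_tendsto n v x hx
  have l4 : Filter.Tendsto (fun k : ℕ => ∫ q, Real.sin q.1 * ⟪gradient (cgA n u (1 / ((k:ℝ) + 1))) (cgT n q),
      gradient (cgA n v (1 / ((k:ℝ) + 1))) q.2.1⟫ ∂(cgmu n))
      Filter.atTop (nhds (∫ q, Real.sin q.1 * ⟪gradient u (cgT n q), gradient v q.2.1⟫ ∂(cgmu n))) := by
    refine tendsto_integral_of_dominated_convergence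
      (fun q => (C + 2 * M) * (D + 2 * N) * (‖cgT n q‖ * ‖q.2.1‖)⁻¹) (fun k => ?_)
      ((cg_J_integrable n hn).const_mul _) (fun k => ?_) ?_
    · have h1 := cg_measurable_gradient n (cgA n u (1 / ((k:ℝ) + 1)))
      have h2 := cg_measurable_gradient n (cgA n v (1 / ((k:ℝ) + 1)))
      have h3 := cgT_meas n
      exact Measurable.aestronglyMeasurable (by fun_prop)
    · filter_upwards [cg_T_ne n hn, cg_X_ne n hn] with q hT hX
      rw [norm_mul]
      calc _ ≤ 1 * (((C + 2 * M) * ‖cgT n q‖⁻¹) * ((D + 2 * N) * ‖q.2.1‖⁻¹)) := by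
            gcongr
            · exact Real.abs_sin_le_one _
            · refine (norm_inner_le_norm _ _).trans ?_
              gcongr
              · exact bd2 u M C huM hC0 hu huC _ (hεk k) _ hT
              · exact bd2 v N D hvN hD0 hv hvD _ (hεk k) _ hX
        _ = _ := by rw [mul_inv]; ring
    · filter_upwards [cg_T_ne n hn, cg_X_ne n hn] with q hT hX
      exact ((cgA_grad_tendsto n u _ hT (hu _ hT)).inner (cgA_grad_tendsto n v _ hX (hv _ hX))).const_mul _
  have l5 := l1.sub (l2.mul l3)
  refine tendsto_nhds_unique l5 (l4.congr fun k => (key k).symm)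

lemma cg_smul (n : ℕ) (f : EuclideanSpace ℝ (Fin n) → ENNReal) (hf : Measurable f) (c : ℝ) (hc : 0 < c) :
    ∫⁻ x, f x = ENNReal.ofReal (c ^ n) * ∫⁻ x, f (c • x) := by
  have h := Measure.map_addHaar_smul (volume : Measure (EuclideanSpace ℝ (Fin n))) hc.ne'
  have h2 : ∫⁻ x, f (c • x) = ENNReal.ofReal ((c ^ n)⁻¹) * ∫⁻ x, f x := by
    rw [← lintegral_map hf (by fun_prop : Measurable fun x : EuclideanSpace ℝ (Fin n) => c • x), h, lintegral_smul_measure]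
    simp [abs_of_pos hc]
  rw [h2, ← mul_assoc, ← ENNReal.ofReal_mul (by positivity), mul_inv_cancel₀ (by positivity)]
  simp

lemma cg_stepA (n : ℕ) (G : EuclideanSpace ℝ (Fin n) × EuclideanSpace ℝ (Fin n) → ENNReal) (hG : Measurable G)
    (s : ℝ) (hs : 0 < Real.sin s) :
    ∫⁻ p, G (Real.cos s • p.1 - Real.sin s • p.2, p.1) ∂((stdGaussian n).prod (stdGaussian n)) =
      ENNReal.ofReal (((2 * π) ^ (-(n : ℝ) / 2)) ^ 2 * Real.sin s ^ n) * ∫⁻ a, ∫⁻ x,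
        ENNReal.ofReal (Real.exp (-(‖a‖ ^ 2 + ‖x‖ ^ 2 - 2 * Real.cos s * ⟪a, x⟫) / 2)) * G (Real.sin s • a, Real.sin s • x) := by
  rw [cg_prod_eq, lintegral_withDensity_eq_lintegral_mul _ (by fun_prop) (by fun_prop)]
  rw [lintegral_prod _ (by fun_prop)]
  simp only [Pi.mul_apply]
  rw [cg_smul n _ _ _ hs]
  swap
  · exact Measurable.lintegral_prod_right' (f := fun p : EuclideanSpace ℝ (Fin n) × EuclideanSpace ℝ (Fin n) =>
      ENNReal.ofReal (((2 * π) ^ (-(n : ℝ) / 2)) ^ 2 * rexp (-(‖p.1‖ ^ 2 + ‖p.2‖ ^ 2) / 2)) *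
        G (Real.cos s • p.1 - Real.sin s • p.2, p.1)) (by fun_prop)
  have e1 : ∀ x : EuclideanSpace ℝ (Fin n), ∫⁻ y, ENNReal.ofReal (((2 * π) ^ (-(n : ℝ) / 2)) ^ 2 * rexp (-(‖Real.sin s • x‖ ^ 2 + ‖y‖ ^ 2) / 2)) *
        G (Real.cos s • (Real.sin s • x) - Real.sin s • y, Real.sin s • x) =
      ENNReal.ofReal (((2 * π) ^ (-(n : ℝ) / 2)) ^ 2) * ∫⁻ a, ENNReal.ofReal (Real.exp (-(‖a‖ ^ 2 + ‖x‖ ^ 2 - 2 * Real.cos s * ⟪a, x⟫) / 2)) * G (Real.sin s • a, Real.sin s • x) := by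
    intro x
    rw [← lintegral_sub_left_eq_self _ (Real.cos s • x), ← lintegral_const_mul _ (by fun_prop)]
    refine lintegral_congr fun a => ?_
    rw [ENNReal.ofReal_mul (by positivity), mul_assoc]
    congr 3
    · congr 1
      rw [norm_sub_sq_real]
      simp only [norm_smul, inner_smul_left, mul_pow, Real.norm_eq_abs, sq_abs, RCLike.conj_to_real]
      have h := Real.sin_sq_add_cos_sq s
      rw [real_inner_comm]
      linear_combination (-1/2 * ‖x‖ ^ 2) * h
    · congr 1
      rw [smul_sub, smul_comm]
      abel
  simp_rw [e1]
  rw [lintegral_const_mul, ← mul_assoc, ← ENNReal.ofReal_mul (by positivity), mul_comm (Real.sin s ^ n)]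
  · congr 1
    exact lintegral_lintegral_swap (by
      simp only [Function.uncurry_def]
      exact Measurable.aemeasurable (by fun_prop))
  · exact Measurable.lintegral_prod_right' (f := fun p : EuclideanSpace ℝ (Fin n) × EuclideanSpace ℝ (Fin n) =>
      ENNReal.ofReal (Real.exp (-(‖p.2‖ ^ 2 + ‖p.1‖ ^ 2 - 2 * Real.cos s * ⟪p.2, p.1⟫) / 2)) * G (Real.sin s • p.2, Real.sin s • p.1)) (by fun_prop)

lemma cg_polar2 (n : ℕ) (hn : 3 ≤ n) (f : EuclideanSpace ℝ (Fin n) × EuclideanSpace ℝ (Fin n) → ENNReal) (hf : Measurable f) :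
    ∫⁻ a, ∫⁻ x, f (a, x) = ENNReal.ofReal ((cgK n)⁻¹ ^ 2) *
      ∫⁻ z, (∫⁻ w, ENNReal.ofReal (w.1 ^ (n-1)) * (ENNReal.ofReal (w.2 ^ (n - 1)) * f (w.1 • z.1, w.2 • z.2))
        ∂((volume.restrict (Set.Ioi (0:ℝ))).prod (volume.restrict (Set.Ioi (0:ℝ)))))
        ∂((sphereUniform n).prod (sphereUniform n)) := by
  have hK := cgK_pos n hn
  have m1 : Measurable (fun a => ∫⁻ x, f (a, x)) := hf.lintegral_prod_right'
  rw [cg_polar n hn _ m1]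
  have e1 : ∀ a, ∫⁻ x, f (a, x) = ENNReal.ofReal (cgK n)⁻¹ * ∫⁻ θ, (∫⁻ r in Set.Ioi (0:ℝ), ENNReal.ofReal (r ^ (n - 1)) * f (a, r • θ)) ∂(sphereUniform n) :=
    fun a => cg_polar n hn _ (by fun_prop)
  have m2 : Measurable (fun p : EuclideanSpace ℝ (Fin n) × EuclideanSpace ℝ (Fin n) =>
      ∫⁻ r in Set.Ioi (0:ℝ), ENNReal.ofReal (r ^ (n - 1)) * f (p.1, r • p.2)) :=
    Measurable.lintegral_prod_right' (f := fun q : (EuclideanSpace ℝ (Fin n) × EuclideanSpace ℝ (Fin n)) × ℝ =>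
      ENNReal.ofReal (q.2 ^ (n - 1)) * f (q.1.1, q.2 • q.1.2)) (by fun_prop)
  have m3 : Measurable (fun a : EuclideanSpace ℝ (Fin n) =>
      ∫⁻ θ, (∫⁻ r in Set.Ioi (0:ℝ), ENNReal.ofReal (r ^ (n - 1)) * f (a, r • θ)) ∂(sphereUniform n)) :=
    m2.lintegral_prod_right'
  have m4 : Measurable (fun a : EuclideanSpace ℝ (Fin n) =>
      ∫⁻ r in Set.Ioi (0:ℝ), ENNReal.ofReal (r ^ (n - 1)) *
      ∫⁻ θ, (∫⁻ r' in Set.Ioi (0:ℝ), ENNReal.ofReal (r' ^ (n - 1)) * f (r • a, r' • θ)) ∂(sphereUniform n)) :=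
    Measurable.lintegral_prod_right' (f := fun q : EuclideanSpace ℝ (Fin n) × ℝ => ENNReal.ofReal (q.2 ^ (n - 1)) *
      ∫⁻ θ, (∫⁻ r' in Set.Ioi (0:ℝ), ENNReal.ofReal (r' ^ (n - 1)) * f (q.2 • q.1, r' • θ)) ∂(sphereUniform n))
      (by
        have := m3.comp (by fun_prop : Measurable fun q : EuclideanSpace ℝ (Fin n) × ℝ => q.2 • q.1)
        simp only [Function.comp_def] at this
        fun_prop)
  simp_rw [e1]
  have e2 : ∀ θ : EuclideanSpace ℝ (Fin n), ∫⁻ r in Set.Ioi (0:ℝ), ENNReal.ofReal (r ^ (n - 1)) * (ENNReal.ofReal (cgK n)⁻¹ *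
      ∫⁻ θ', (∫⁻ r' in Set.Ioi (0:ℝ), ENNReal.ofReal (r' ^ (n - 1)) * f (r • θ, r' • θ')) ∂(sphereUniform n)) =
      ENNReal.ofReal (cgK n)⁻¹ * ∫⁻ r in Set.Ioi (0:ℝ), ENNReal.ofReal (r ^ (n - 1)) *
      ∫⁻ θ', (∫⁻ r' in Set.Ioi (0:ℝ), ENNReal.ofReal (r' ^ (n - 1)) * f (r • θ, r' • θ')) ∂(sphereUniform n) := by
    intro θ
    rw [← lintegral_const_mul]
    · refine lintegral_congr fun r => by ring
    · have := m3.comp (by fun_prop : Measurable fun r : ℝ => r • θ)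
      simp only [Function.comp_def] at this
      fun_prop
  simp_rw [e2]
  rw [lintegral_const_mul _ m4, ← mul_assoc, ← ENNReal.ofReal_mul (by positivity), ← pow_two]
  congr 1
  rw [lintegral_prod]
  swap
  · exact (Measurable.lintegral_prod_right' (f := fun q : (EuclideanSpace ℝ (Fin n) × EuclideanSpace ℝ (Fin n)) × (ℝ × ℝ) =>
      ENNReal.ofReal (q.2.1 ^ (n-1)) * (ENNReal.ofReal (q.2.2 ^ (n - 1)) * f (q.2.1 • q.1.1, q.2.2 • q.1.2))) (by fun_prop)).aemeasurable
  refine lintegral_congr fun θ => ?_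
  have e3 : ∀ r : ℝ, ENNReal.ofReal (r ^ (n - 1)) *
      ∫⁻ θ', (∫⁻ r' in Set.Ioi (0:ℝ), ENNReal.ofReal (r' ^ (n - 1)) * f (r • θ, r' • θ')) ∂(sphereUniform n) =
      ∫⁻ θ', (∫⁻ r' in Set.Ioi (0:ℝ), ENNReal.ofReal (r ^ (n - 1)) * (ENNReal.ofReal (r' ^ (n - 1)) * f (r • θ, r' • θ'))) ∂(sphereUniform n) := by
    intro r
    rw [← lintegral_const_mul]
    · refine lintegral_congr fun θ' => ?_
      rw [← lintegral_const_mul _ (by fun_prop)]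
    · exact m2.comp (by fun_prop : Measurable fun θ' : EuclideanSpace ℝ (Fin n) => (r • θ, θ'))
  simp_rw [e3]
  rw [lintegral_lintegral_swap]
  · refine lintegral_congr fun θ' => ?_
    rw [lintegral_prod _ (by fun_prop)]
  · refine Measurable.aemeasurable ?_
    simp only [Function.uncurry_def]
    exact Measurable.lintegral_prod_right' (f := fun q : (ℝ × EuclideanSpace ℝ (Fin n)) × ℝ =>
      ENNReal.ofReal (q.1.1 ^ (n - 1)) * (ENNReal.ofReal (q.2 ^ (n - 1)) * f (q.1.1 • θ, q.2 • q.1.2))) (by fun_prop)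

noncomputable def cgI (n : ℕ) (t α : ℝ) : ENNReal :=
  ∫⁻ w, ENNReal.ofReal (Real.exp (-(w.1 ^ 2 + w.2 ^ 2 - 2 * w.1 * w.2 * t * α) / 2) * (w.1 * w.2) ^ ((n : ℝ) - 2))
    ∂((volume.restrict (Set.Ioi (0:ℝ))).prod (volume.restrict (Set.Ioi (0:ℝ))))

noncomputable def cgc (n : ℕ) : ℝ := 1 / (2 ^ ((n : ℝ) - 2) * Real.Gamma ((n : ℝ) / 2) ^ 2)

noncomputable def cgPsi (n : ℕ) (α : ℝ) : ENNReal :=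
  ENNReal.ofReal (cgc n) * ∫⁻ t in Set.Ioo (0:ℝ) 1, ENNReal.ofReal ((1 - t ^ 2) ^ (((n : ℝ) - 2) / 2)) * cgI n t α

lemma cgc_nonneg (n : ℕ) : 0 ≤ cgc n := by unfold cgc; positivity

lemma cgc_eq (n : ℕ) (hn : 3 ≤ n) : ((2 * π) ^ (-(n : ℝ) / 2)) ^ 2 * (cgK n)⁻¹ ^ 2 = cgc n := by
  have hG : 0 < Real.Gamma ((n : ℝ) / 2) := Real.Gamma_pos_of_pos (by
    have : (3:ℝ) ≤ n := by exact_mod_cast hn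
    linarith)
  have hp : 0 < (2 * π) ^ (-(n : ℝ) / 2) := by positivity
  have h2 : (2:ℝ) ^ ((n : ℝ) - 2) = (2 ^ ((n : ℝ) / 2 - 1)) ^ 2 := by
    rw [← Real.rpow_natCast, ← Real.rpow_mul (by norm_num)]
    congr 1
    push_cast; ring
  unfold cgc cgK
  rw [h2]
  have : (0:ℝ) < 2 ^ ((n : ℝ) / 2 - 1) := by positivity
  field_simp

lemma cgI_meas (n : ℕ) : Measurable (fun p : ℝ × ℝ => cgI n p.1 p.2) := by
  unfold cgI
  exact Measurable.lintegral_prod_right' (f := fun q : (ℝ × ℝ) × (ℝ × ℝ) =>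
    ENNReal.ofReal (Real.exp (-(q.2.1 ^ 2 + q.2.2 ^ 2 - 2 * q.2.1 * q.2.2 * q.1.1 * q.1.2) / 2) * (q.2.1 * q.2.2) ^ ((n : ℝ) - 2)))
    (by fun_prop)

lemma cgPsi_meas (n : ℕ) : Measurable (cgPsi n) := by
  unfold cgPsi
  refine Measurable.const_mul ?_ _
  have h := cgI_meas n
  exact Measurable.lintegral_prod_right' (f := fun q : ℝ × ℝ =>
    ENNReal.ofReal ((1 - q.2 ^ 2) ^ (((n : ℝ) - 2) / 2)) * cgI n q.2 q.1) (by
      have := h.comp (measurable_snd.prodMk measurable_fst : Measurable fun q : ℝ × ℝ => (q.2, q.1))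
      simp only [Function.comp_def] at this
      fun_prop)

lemma cg_stepB (n : ℕ) (hn : 3 ≤ n) (F : EuclideanSpace ℝ (Fin n) × EuclideanSpace ℝ (Fin n) → ENNReal) (hF : Measurable F)
    (s : ℝ) (hs : 0 < Real.sin s) :
    ∫⁻ p, ENNReal.ofReal ((‖Real.cos s • p.1 - Real.sin s • p.2‖ * ‖p.1‖)⁻¹) *
      F (‖Real.cos s • p.1 - Real.sin s • p.2‖⁻¹ • (Real.cos s • p.1 - Real.sin s • p.2), ‖p.1‖⁻¹ • p.1)
      ∂((stdGaussian n).prod (stdGaussian n)) =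
      ENNReal.ofReal (cgc n * Real.sin s ^ (n - 2)) * ∫⁻ z, F z * cgI n (Real.cos s) ⟪z.1, z.2⟫
        ∂((sphereUniform n).prod (sphereUniform n)) := by
  have h := cg_stepA n (fun q => ENNReal.ofReal ((‖q.1‖ * ‖q.2‖)⁻¹) * F (‖q.1‖⁻¹ • q.1, ‖q.2‖⁻¹ • q.2)) (by fun_prop) s hs
  simp only at h
  rw [h]
  have h2 := cg_polar2 n hn (fun q => ENNReal.ofReal (rexp (-(‖q.1‖ ^ 2 + ‖q.2‖ ^ 2 - 2 * Real.cos s * ⟪q.1, q.2⟫) / 2)) *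
        (ENNReal.ofReal (‖Real.sin s • q.1‖ * ‖Real.sin s • q.2‖)⁻¹ *
          F (‖Real.sin s • q.1‖⁻¹ • Real.sin s • q.1, ‖Real.sin s • q.2‖⁻¹ • Real.sin s • q.2))) (by fun_prop)
  simp only at h2
  rw [h2]
  have hae : ∀ᵐ z ∂((sphereUniform n).prod (sphereUniform n)), ‖z.1‖ = 1 ∧ ‖z.2‖ = 1 := by
    have a := Measure.quasiMeasurePreserving_fst (μ := sphereUniform n) (ν := sphereUniform n) |>.ae (cg_sphere_norm n hn)
    have b := Measure.quasiMeasurePreserving_snd (μ := sphereUniform n) (ν := sphereUniform n) |>.ae (cg_sphere_norm n hn)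
    filter_upwards [a, b] with z h1 h2 using ⟨h1, h2⟩
  have key : ∀ᵐ z ∂((sphereUniform n).prod (sphereUniform n)),
     ∫⁻ w, ENNReal.ofReal (w.1 ^ (n - 1)) * (ENNReal.ofReal (w.2 ^ (n - 1)) *
       (ENNReal.ofReal (rexp (-(‖w.1 • z.1‖ ^ 2 + ‖w.2 • z.2‖ ^ 2 - 2 * Real.cos s * ⟪w.1 • z.1, w.2 • z.2⟫) / 2)) *
        (ENNReal.ofReal (‖Real.sin s • w.1 • z.1‖ * ‖Real.sin s • w.2 • z.2‖)⁻¹ *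
          F (‖Real.sin s • w.1 • z.1‖⁻¹ • Real.sin s • w.1 • z.1, ‖Real.sin s • w.2 • z.2‖⁻¹ • Real.sin s • w.2 • z.2))))
        ∂((volume.restrict (Set.Ioi (0:ℝ))).prod (volume.restrict (Set.Ioi (0:ℝ)))) =
      ENNReal.ofReal ((Real.sin s ^ 2)⁻¹) * (F z * cgI n (Real.cos s) ⟪z.1, z.2⟫) := by
    filter_upwards [hae] with z hz
    rw [cgI, ← lintegral_const_mul _ (by fun_prop), ← lintegral_const_mul _ (by fun_prop)]
    rw [Measure.prod_restrict]
    refine setLIntegral_congr_fun (measurableSet_Ioi.prod measurableSet_Ioi) ?_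
    rintro ⟨r, r'⟩ ⟨hr, hr'⟩
    simp only [Set.mem_Ioi] at hr hr'
    have n1 : ∀ (r : ℝ) (hr : 0 < r) (x : EuclideanSpace ℝ (Fin n)), ‖x‖ = 1 → ‖Real.sin s • r • x‖ = Real.sin s * r := by
      intro r hr x hx
      rw [norm_smul, norm_smul, hx, Real.norm_eq_abs, Real.norm_eq_abs, abs_of_pos hs, abs_of_pos hr, mul_one]
    have n2 : ∀ (r : ℝ) (hr : 0 < r) (x : EuclideanSpace ℝ (Fin n)), (Real.sin s * r)⁻¹ • Real.sin s • r • x = x := by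
      intro r hr x
      rw [smul_smul, smul_smul, mul_assoc, inv_mul_cancel₀ (by positivity), one_smul]
    simp only [n1 r hr _ hz.1, n1 r' hr' _ hz.2, n2 r hr, n2 r' hr']
    simp only [norm_smul, hz.1, hz.2, inner_smul_left, inner_smul_right, Real.norm_eq_abs, mul_one, sq_abs, RCLike.conj_to_real]
    have e1 : (r * r') ^ ((n:ℝ) - 2) = (r * r') ^ (n - 2) := by
      rw [← Real.rpow_natCast]
      congr 1
      push_cast [Nat.cast_sub (by omega : 2 ≤ n)]
      rfl
    rw [e1]
    have e2 : n - 1 = (n - 2) + 1 := by omega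
    have e3 : -(r ^ 2 + r' ^ 2 - 2 * Real.cos s * (r * (r' * ⟪z.1, z.2⟫))) / 2 = -(r ^ 2 + r' ^ 2 - 2 * r * r' * Real.cos s * ⟪z.1, z.2⟫) / 2 := by ring
    have e3' : -(r ^ 2 + r' ^ 2 - 2 * Real.cos s * (r' * (r * ⟪z.1, z.2⟫))) / 2 = -(r ^ 2 + r' ^ 2 - 2 * r * r' * Real.cos s * ⟪z.1, z.2⟫) / 2 := by ring
    first | rw [e3] | rw [e3']
    have e4 : r ^ (n - 1) * (r' ^ (n - 1) * (rexp (-(r ^ 2 + r' ^ 2 - 2 * r * r' * Real.cos s * ⟪z.1, z.2⟫) / 2) * (Real.sin s * r * (Real.sin s * r'))⁻¹))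
       = (Real.sin s ^ 2)⁻¹ * (rexp (-(r ^ 2 + r' ^ 2 - 2 * r * r' * Real.cos s * ⟪z.1, z.2⟫) / 2) * (r * r') ^ (n - 2)) := by
      rw [e2, pow_succ, pow_succ, mul_pow]
      field_simp
    have e5 := congrArg ENNReal.ofReal e4
    rw [ENNReal.ofReal_mul (by positivity), ENNReal.ofReal_mul (by positivity), ENNReal.ofReal_mul (by positivity), ENNReal.ofReal_mul (by positivity)] at e5
    calc _ = (ENNReal.ofReal (r ^ (n - 1)) * (ENNReal.ofReal (r' ^ (n - 1)) * (ENNReal.ofReal (rexp (-(r ^ 2 + r' ^ 2 - 2 * r * r' * Real.cos s * ⟪z.1, z.2⟫) / 2)) * ENNReal.ofReal ((Real.sin s * r * (Real.sin s * r'))⁻¹)))) * F z := by ring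
      _ = _ := by rw [e5]; ring
  rw [lintegral_congr_ae key, lintegral_const_mul, ← mul_assoc, ← mul_assoc, ← ENNReal.ofReal_mul (by positivity), ← ENNReal.ofReal_mul (by positivity)]
  · congr 2
    rw [← cgc_eq n hn]
    have e2 : n = (n - 2) + 2 := by omega
    rw [show Real.sin s ^ n = Real.sin s ^ (n - 2) * Real.sin s ^ 2 by rw [← pow_add, ← e2]]
    field_simp
  · have := (cgI_meas n).comp (by fun_prop : Measurable fun z : EuclideanSpace ℝ (Fin n) × EuclideanSpace ℝ (Fin n) => (Real.cos s, ⟪z.1, z.2⟫))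
    simp only [Function.comp_def] at this
    fun_prop

lemma cg_subst (n : ℕ) (hn : 3 ≤ n) (g : ℝ → ENNReal) :
    ∫⁻ s in Set.Ioo 0 (π / 2), ENNReal.ofReal (Real.sin s) * (ENNReal.ofReal (Real.sin s ^ (n - 2)) * g (Real.cos s)) =
      ∫⁻ t in Set.Ioo (0:ℝ) 1, ENNReal.ofReal ((1 - t ^ 2) ^ (((n : ℝ) - 2) / 2)) * g t := by
  have him : Real.cos '' (Set.Ioo 0 (π / 2)) = Set.Ioo 0 1 := by
    ext t
    constructor
    · rintro ⟨s, hs, rfl⟩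
      refine ⟨Real.cos_pos_of_mem_Ioo ⟨by linarith [hs.1, Real.pi_pos], hs.2⟩, ?_⟩
      rw [← Real.cos_zero]
      exact Real.cos_lt_cos_of_nonneg_of_le_pi le_rfl (by linarith [hs.2, Real.pi_pos]) hs.1
    · rintro ⟨h0, h1⟩
      exact ⟨Real.arccos t, ⟨Real.arccos_pos.2 h1, Real.arccos_lt_pi_div_two.2 h0⟩, Real.cos_arccos (by linarith) h1.le⟩
  have hinj : Set.InjOn Real.cos (Set.Ioo 0 (π / 2)) :=
    Real.injOn_cos.mono (fun s hs => ⟨hs.1.le, by linarith [hs.2, Real.pi_pos]⟩ : Set.Ioo 0 (π / 2) ⊆ Set.Icc 0 π)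
  have h := lintegral_image_eq_lintegral_abs_deriv_mul (f' := fun s => -Real.sin s) measurableSet_Ioo
    (fun s _ => (Real.hasDerivAt_cos s).hasDerivWithinAt) hinj
    (fun t => ENNReal.ofReal ((1 - t ^ 2) ^ (((n : ℝ) - 2) / 2)) * g t)
  rw [him] at h
  rw [h]
  refine setLIntegral_congr_fun measurableSet_Ioo fun s hs => ?_
  have hsin : 0 < Real.sin s := Real.sin_pos_of_pos_of_lt_pi hs.1 (by linarith [hs.2, Real.pi_pos])
  simp only [abs_neg, abs_of_pos hsin]
  congr 3
  rw [← Real.sin_sq, ← Real.rpow_natCast, ← Real.rpow_natCast, ← Real.rpow_mul hsin.le]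
  congr 1
  push_cast [Nat.cast_sub (by omega : 2 ≤ n)]
  ring

set_option maxHeartbeats 1000000 in
lemma cg_L (n : ℕ) (hn : 3 ≤ n) (F : EuclideanSpace ℝ (Fin n) × EuclideanSpace ℝ (Fin n) → ENNReal) (hF : Measurable F) :
    ∫⁻ q, ENNReal.ofReal (Real.sin q.1 * (‖cgT n q‖ * ‖q.2.1‖)⁻¹) *
      F (‖cgT n q‖⁻¹ • cgT n q, ‖q.2.1‖⁻¹ • q.2.1) ∂(cgmu n) =
    ∫⁻ z, F z * cgPsi n ⟪z.1, z.2⟫ ∂((sphereUniform n).prod (sphereUniform n)) := by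
  have hT := cgT_meas n
  have mI := cgI_meas n
  unfold cgmu
  rw [lintegral_prod _ (by fun_prop)]
  have h1 : ∀ s ∈ Set.Ioo 0 (π / 2), ∫⁻ p, ENNReal.ofReal (Real.sin s * (‖cgT n (s, p)‖ * ‖p.1‖)⁻¹) *
      F (‖cgT n (s, p)‖⁻¹ • cgT n (s, p), ‖p.1‖⁻¹ • p.1) ∂((stdGaussian n).prod (stdGaussian n)) =
      ENNReal.ofReal (Real.sin s) * (ENNReal.ofReal (Real.sin s ^ (n - 2)) *
        (ENNReal.ofReal (cgc n) * ∫⁻ z, F z * cgI n (Real.cos s) ⟪z.1, z.2⟫ ∂((sphereUniform n).prod (sphereUniform n)))) := by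
    intro s hs
    have hsin : 0 < Real.sin s := Real.sin_pos_of_pos_of_lt_pi hs.1 (by linarith [hs.2, Real.pi_pos])
    have hB := cg_stepB n hn F hF s hsin
    rw [mul_comm (cgc n), ENNReal.ofReal_mul (by positivity), mul_assoc] at hB
    rw [← hB, ← lintegral_const_mul _ (by fun_prop)]
    refine lintegral_congr fun p => ?_
    rw [ENNReal.ofReal_mul hsin.le, mul_assoc]
    rfl
  rw [setLIntegral_congr_fun measurableSet_Ioo h1]
  rw [cg_subst n hn (fun t => ENNReal.ofReal (cgc n) * ∫⁻ z, F z * cgI n t ⟪z.1, z.2⟫ ∂((sphereUniform n).prod (sphereUniform n)))]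
  have mt : ∀ t, Measurable fun z : EuclideanSpace ℝ (Fin n) × EuclideanSpace ℝ (Fin n) => F z * cgI n t ⟪z.1, z.2⟫ := by
    intro t
    have := mI.comp (by fun_prop : Measurable fun z : EuclideanSpace ℝ (Fin n) × EuclideanSpace ℝ (Fin n) => (t, ⟪z.1, z.2⟫))
    simp only [Function.comp_def] at this
    fun_prop
  have mz : ∀ a : ℝ, Measurable fun t => cgI n t a := by
    intro a
    have h0 : Measurable fun t : ℝ => (t, a) := by fun_prop
    have := Measurable.comp mI h0
    simpa only [Function.comp_def] using this
  have h2 : ∀ t : ℝ, ENNReal.ofReal ((1 - t ^ 2) ^ (((n : ℝ) - 2) / 2)) * (ENNReal.ofReal (cgc n) * ∫⁻ z, F z * cgI n t ⟪z.1, z.2⟫ ∂((sphereUniform n).prod (sphereUniform n)))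
      = ∫⁻ z, ENNReal.ofReal ((1 - t ^ 2) ^ (((n : ℝ) - 2) / 2)) * (ENNReal.ofReal (cgc n) * (F z * cgI n t ⟪z.1, z.2⟫)) ∂((sphereUniform n).prod (sphereUniform n)) := by
    intro t
    rw [lintegral_const_mul _ ((mt t).const_mul _), lintegral_const_mul _ (mt t)]
  rw [lintegral_congr h2, lintegral_lintegral_swap]
  · refine lintegral_congr fun z => ?_
    have := mz ⟪z.1, z.2⟫
    rw [cgPsi, ← lintegral_const_mul _ (by fun_prop), ← lintegral_const_mul _ (by fun_prop)]
    refine lintegral_congr fun t => by ring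
  · refine Measurable.aemeasurable ?_
    simp only [Function.uncurry_def]
    have := mI.comp (by fun_prop : Measurable fun p : ℝ × (EuclideanSpace ℝ (Fin n) × EuclideanSpace ℝ (Fin n)) => (p.1, ⟪p.2.1, p.2.2⟫))
    simp only [Function.comp_def] at this
    fun_prop

lemma cgPsi_toReal (n : ℕ) (α : ℝ) (h : cgPsi n α ≠ ⊤) (hn : 3 ≤ n) : (cgPsi n α).toReal = psi n α := by
  have hG : 0 < Real.Gamma ((n : ℝ) / 2) := Real.Gamma_pos_of_pos (by
    have : (3:ℝ) ≤ n := by exact_mod_cast hn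
    linarith)
  have hc : 0 < cgc n := by unfold cgc; positivity
  set f : ℝ × (ℝ × ℝ) → ℝ := fun q => (1 - q.1 ^ 2) ^ (((n : ℝ) - 2) / 2) *
    (Real.exp (-(q.2.1 ^ 2 + q.2.2 ^ 2 - 2 * q.2.1 * q.2.2 * q.1 * α) / 2) * (q.2.1 * q.2.2) ^ ((n : ℝ) - 2)) with hf
  have mf : Measurable f := by rw [hf]; fun_prop
  set ν := (volume.restrict (Set.Ioi (0:ℝ))).prod (volume.restrict (Set.Ioi (0:ℝ))) with hν
  set m := (volume.restrict (Set.Ioo (0:ℝ) 1)).prod ν with hm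
  have hpos : ∀ᵐ q ∂m, 0 ≤ f q := by
    rw [hm, hν, Measure.prod_restrict, Measure.prod_restrict]
    refine (ae_restrict_iff' (measurableSet_Ioo.prod (measurableSet_Ioi.prod measurableSet_Ioi))).2 (Filter.Eventually.of_forall ?_)
    rintro ⟨t, r, r'⟩ ⟨ht, hr, hr'⟩
    simp only [Set.mem_Ioi, Set.mem_Ioo] at ht hr hr'
    have : 0 ≤ 1 - t ^ 2 := by nlinarith [ht.1, ht.2]
    simp only [hf]
    positivity
  have hl : ∫⁻ q, ENNReal.ofReal (f q) ∂m = ∫⁻ t in Set.Ioo (0:ℝ) 1, ENNReal.ofReal ((1 - t ^ 2) ^ (((n : ℝ) - 2) / 2)) * cgI n t α := by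
    rw [hm, lintegral_prod _ (by fun_prop)]
    refine setLIntegral_congr_fun measurableSet_Ioo fun t ht => ?_
    have : 0 ≤ 1 - t ^ 2 := by nlinarith [ht.1, ht.2]
    simp only [cgI, hf]
    rw [← lintegral_const_mul _ (by fun_prop)]
    refine lintegral_congr fun w => ?_
    rw [ENNReal.ofReal_mul (by positivity)]
  have hfin : ∫⁻ q, ENNReal.ofReal (f q) ∂m ≠ ⊤ := by
    rw [hl]
    intro ht
    apply h
    rw [cgPsi, ht, ENNReal.mul_top]
    simpa using hc
  have hint : Integrable f m := by
    refine ⟨mf.aestronglyMeasurable, ?_⟩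
    rw [hasFiniteIntegral_iff_ofReal hpos]
    exact lt_top_iff_ne_top.2 hfin
  have e1 : (∫⁻ q, ENNReal.ofReal (f q) ∂m).toReal = ∫ q, f q ∂m := by
    rw [integral_eq_lintegral_of_nonneg_ae hpos mf.aestronglyMeasurable]
  rw [cgPsi, ENNReal.toReal_mul, ENNReal.toReal_ofReal hc.le, ← hl, e1, psi]
  change cgc n * _ = cgc n * _
  congr 1
  rw [hm, integral_prod f hint]
  refine integral_congr_ae ?_
  filter_upwards [hint.prod_right_ae] with t ht
  rw [hν, integral_prod _ ht]
  simp only [hf, integral_const_mul]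

lemma cgPsi_fin (n : ℕ) (hn : 3 ≤ n) :
    ∫⁻ z, cgPsi n ⟪z.1, z.2⟫ ∂((sphereUniform n).prod (sphereUniform n)) ≠ ⊤ := by
  have h := cg_L n hn (fun _ => 1) measurable_const
  simp only [one_mul, mul_one] at h
  rw [← h]
  have hJ := (cg_J_integrable n hn).2
  rw [hasFiniteIntegral_iff_ofReal (Filter.Eventually.of_forall fun q => by positivity)] at hJ
  refine (lt_of_le_of_lt (lintegral_mono fun q => ENNReal.ofReal_le_ofReal ?_) hJ).ne
  exact mul_le_of_le_one_left (by positivity) (Real.sin_le_one _)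

lemma cgPsi_inner_meas (n : ℕ) :
    Measurable fun z : EuclideanSpace ℝ (Fin n) × EuclideanSpace ℝ (Fin n) => cgPsi n ⟪z.1, z.2⟫ := by
  have h0 : Measurable fun z : EuclideanSpace ℝ (Fin n) × EuclideanSpace ℝ (Fin n) => ⟪z.1, z.2⟫ := by fun_prop
  have := (cgPsi_meas n).comp h0
  simpa only [Function.comp_def] using this

lemma cgPsi_ae (n : ℕ) (hn : 3 ≤ n) :
    ∀ᵐ z ∂((sphereUniform n).prod (sphereUniform n)), (cgPsi n ⟪z.1, z.2⟫).toReal = psi n ⟪z.1, z.2⟫ := by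
  filter_upwards [ae_lt_top (cgPsi_inner_meas n) (cgPsi_fin n hn)] with z hz
  exact cgPsi_toReal n _ hz.ne hn

lemma cgPsi_integrable (n : ℕ) (hn : 3 ≤ n) :
    Integrable (fun z : EuclideanSpace ℝ (Fin n) × EuclideanSpace ℝ (Fin n) => psi n ⟪z.1, z.2⟫)
      ((sphereUniform n).prod (sphereUniform n)) :=
  (integrable_toReal_of_lintegral_ne_top (cgPsi_inner_meas n).aemeasurable (cgPsi_fin n hn)).congr (cgPsi_ae n hn)

lemma cg_sin_nonneg (n : ℕ) : ∀ᵐ q ∂(cgmu n), 0 ≤ Real.sin q.1 := by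
  have h : ∀ᵐ s ∂(volume.restrict (Set.Ioo 0 (π / 2))), 0 ≤ Real.sin s := by
    refine (ae_restrict_iff' measurableSet_Ioo).2 (Filter.Eventually.of_forall fun s hs => ?_)
    exact Real.sin_nonneg_of_nonneg_of_le_pi hs.1.le (by linarith [hs.2, Real.pi_pos])
  exact (Measure.quasiMeasurePreserving_fst (μ := volume.restrict (Set.Ioo 0 (π/2)))
    (ν := (stdGaussian n).prod (stdGaussian n))).ae h

lemma cg_transfer (n : ℕ) (hn : 3 ≤ n) (H : EuclideanSpace ℝ (Fin n) × EuclideanSpace ℝ (Fin n) → ℝ) (hH : Measurable H) :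
    ∫ q, (Real.sin q.1 * (‖cgT n q‖ * ‖q.2.1‖)⁻¹) *
      H (‖cgT n q‖⁻¹ • cgT n q, ‖q.2.1‖⁻¹ • q.2.1) ∂(cgmu n) =
    ∫ z, H z * psi n ⟪z.1, z.2⟫ ∂((sphereUniform n).prod (sphereUniform n)) := by
  have hT := cgT_meas n
  have mP := cgPsi_inner_meas n
  set w : ℝ × (EuclideanSpace ℝ (Fin n) × EuclideanSpace ℝ (Fin n)) → ENNReal :=
    fun q => ENNReal.ofReal (Real.sin q.1 * (‖cgT n q‖ * ‖q.2.1‖)⁻¹) with hw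
  have mw : Measurable w := by rw [hw]; fun_prop
  set Θ : ℝ × (EuclideanSpace ℝ (Fin n) × EuclideanSpace ℝ (Fin n)) → EuclideanSpace ℝ (Fin n) × EuclideanSpace ℝ (Fin n) :=
    fun q => (‖cgT n q‖⁻¹ • cgT n q, ‖q.2.1‖⁻¹ • q.2.1) with hΘ
  have mΘ : Measurable Θ := by rw [hΘ]; fun_prop
  have hmeas : ((cgmu n).withDensity w).map Θ =
      ((sphereUniform n).prod (sphereUniform n)).withDensity (fun z => cgPsi n ⟪z.1, z.2⟫) := by
    refine Measure.ext_of_lintegral _ fun F hF => ?_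
    rw [lintegral_map hF mΘ, lintegral_withDensity_eq_lintegral_mul (g := fun q => F (Θ q)) _ mw (hF.comp mΘ),
      lintegral_withDensity_eq_lintegral_mul _ mP hF]
    simp only [Pi.mul_apply]
    have := cg_L n hn F hF
    refine Eq.trans this (lintegral_congr fun z => ?_)
    rw [mul_comm]
  have h1 : ∫ z, H z ∂(((cgmu n).withDensity w).map Θ) = ∫ q, (w q).toReal • H (Θ q) ∂(cgmu n) := by
    rw [integral_map mΘ.aemeasurable hH.aestronglyMeasurable,
      integral_withDensity_eq_integral_toReal_smul mw (Filter.Eventually.of_forall fun q => by simp [hw])]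
  have h2 : ∫ z, H z ∂(((cgmu n).withDensity w).map Θ) = ∫ z, (cgPsi n ⟪z.1, z.2⟫).toReal • H z ∂((sphereUniform n).prod (sphereUniform n)) := by
    rw [hmeas, integral_withDensity_eq_integral_toReal_smul mP (ae_lt_top mP (cgPsi_fin n hn))]
  have h3 : ∫ q, (Real.sin q.1 * (‖cgT n q‖ * ‖q.2.1‖)⁻¹) * H (Θ q) ∂(cgmu n) = ∫ q, (w q).toReal • H (Θ q) ∂(cgmu n) := by
    refine integral_congr_ae ?_
    filter_upwards [cg_sin_nonneg n] with q hq
    simp only [hw, smul_eq_mul]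
    rw [ENNReal.toReal_ofReal (by positivity)]
  rw [h3, ← h1, h2]
  refine integral_congr_ae ?_
  filter_upwards [cgPsi_ae n hn] with z hz
  rw [hz, smul_eq_mul, mul_comm]

lemma cg_grad_hom (n : ℕ) (u : EuclideanSpace ℝ (Fin n) → ℝ)
    (huh : ∀ r : ℝ, 0 < r → ∀ x : EuclideanSpace ℝ (Fin n), x ≠ 0 → u (r • x) = u x)
    (r : ℝ) (hr : 0 < r) (x : EuclideanSpace ℝ (Fin n)) (hx : x ≠ 0) :
    gradient u x = r • gradient u (r • x) := by
  have h := fderiv_comp_smul (𝕜 := ℝ) (f := u) (x := x) r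
  have h2 : fderiv ℝ (fun x => u (r • x)) x = fderiv ℝ u x := by
    refine Filter.EventuallyEq.fderiv_eq ?_
    filter_upwards [isOpen_compl_singleton.mem_nhds hx] with y hy
    exact huh r hr y hy
  rw [h2] at h
  simp only [gradient]
  rw [h, map_smulₛₗ]
  simp

lemma cg_data (n : ℕ) (u : EuclideanSpace ℝ (Fin n) → ℝ)
    (hu : ContDiffOn ℝ 1 u {(0 : EuclideanSpace ℝ (Fin n))}ᶜ)
    (huh : ∀ r : ℝ, 0 < r → ∀ x : EuclideanSpace ℝ (Fin n), x ≠ 0 → u (r • x) = u x) :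
    Measurable u ∧ (∀ x, x ≠ 0 → DifferentiableAt ℝ u x) ∧ (∃ M, ∀ x, |u x| ≤ M) ∧
    ∃ C, 0 ≤ C ∧ ∀ x, x ≠ 0 → ‖gradient u x‖ ≤ C * ‖x‖⁻¹ := by
  have hcomp := isCompact_sphere (0 : EuclideanSpace ℝ (Fin n)) 1
  have hsub : Metric.sphere (0 : EuclideanSpace ℝ (Fin n)) 1 ⊆ {0}ᶜ := by
    intro x hx h0
    simp only [Set.mem_singleton_iff] at h0
    simp [h0] at hx
  have hsph : ∀ x : EuclideanSpace ℝ (Fin n), x ≠ 0 → ‖x‖⁻¹ • x ∈ Metric.sphere (0 : EuclideanSpace ℝ (Fin n)) 1 := by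
    intro x hx
    have : 0 < ‖x‖ := norm_pos_iff.2 hx
    simp [norm_smul, this.ne']
  refine ⟨measurable_of_continuousOn_compl_singleton 0 hu.continuousOn, ?_, ?_, ?_⟩
  · intro x hx
    exact (hu.differentiableOn (by norm_num)).differentiableAt (isOpen_compl_singleton.mem_nhds hx)
  · obtain ⟨M, hM⟩ := hcomp.exists_bound_of_continuousOn (hu.continuousOn.mono hsub)
    refine ⟨max M |u 0|, fun x => ?_⟩
    by_cases hx : x = 0
    · rw [hx]; exact le_max_right _ _
    · have h1 := hM _ (hsph x hx)
      rw [huh _ (inv_pos.2 (norm_pos_iff.2 hx)) x hx] at h1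
      exact h1.trans (le_max_left _ _)
  · obtain ⟨C, hC⟩ := hcomp.exists_bound_of_continuousOn
      ((hu.continuousOn_fderiv_of_isOpen isOpen_compl_singleton le_rfl).mono hsub)
    refine ⟨max C 0, le_max_right _ _, fun x hx => ?_⟩
    have hp : 0 < ‖x‖⁻¹ := inv_pos.2 (norm_pos_iff.2 hx)
    rw [cg_grad_hom n u huh _ hp x hx, norm_smul, cg_norm_gradient, norm_inv, norm_norm, mul_comm]
    have h1 := hC _ (hsph x hx)
    gcongr
    exact h1.trans (le_max_left _ _)

lemma cg_sphere_int (n : ℕ) (hn : 3 ≤ n) (f : EuclideanSpace ℝ (Fin n) → ℝ) (hf : Measurable f)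
    (hfh : ∀ r : ℝ, 0 < r → ∀ x : EuclideanSpace ℝ (Fin n), x ≠ 0 → f (r • x) = f x) :
    ∫ x, f x ∂(sphereUniform n) = ∫ x, f x ∂(stdGaussian n) := by
  rw [sphereUniform, integral_map (by fun_prop) hf.aestronglyMeasurable]
  refine integral_congr_ae ?_
  filter_upwards [cg_gauss_ne n hn] with x hx
  exact hfh _ (inv_pos.2 (norm_pos_iff.2 hx)) x hx

/-- Spherical covariance representation on `S^{n-1}`, `n ≥ 3`. -/
theorem statement2 (n : ℕ) (hn : 3 ≤ n) (u v : EuclideanSpace ℝ (Fin n) → ℝ)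
    (hu : ContDiffOn ℝ 1 u {(0 : EuclideanSpace ℝ (Fin n))}ᶜ)
    (hv : ContDiffOn ℝ 1 v {(0 : EuclideanSpace ℝ (Fin n))}ᶜ)
    (huh : ∀ r : ℝ, 0 < r → ∀ x : EuclideanSpace ℝ (Fin n), x ≠ 0 → u (r • x) = u x)
    (hvh : ∀ r : ℝ, 0 < r → ∀ x : EuclideanSpace ℝ (Fin n), x ≠ 0 → v (r • x) = v x) :
    (∫ x, u x * v x ∂(sphereUniform n)) -
        (∫ x, u x ∂(sphereUniform n)) * (∫ x, v x ∂(sphereUniform n)) =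
      ∫ x, (∫ y, ⟪gradient u x, gradient v y⟫ * psi n ⟪x, y⟫
        ∂(sphereUniform n)) ∂(sphereUniform n) := by
  obtain ⟨um, ud, ⟨M, hM⟩, C, hC0, hC⟩ := cg_data n u hu huh
  obtain ⟨vm, vd, ⟨N, hN⟩, D, hD0, hD⟩ := cg_data n v hv hvh
  have mgu := cg_measurable_gradient n u
  have mgv := cg_measurable_gradient n v
  rw [cg_sphere_int n hn u um huh, cg_sphere_int n hn v vm hvh,
    cg_sphere_int n hn (fun x => u x * v x) (um.mul vm) (fun r hr x hx => by
      simp only [huh r hr x hx, hvh r hr x hx])]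
  rw [cg_cov_sing n hn u v ud vd M C N D hC0 hD0 hM hC hN hD]
  set H : EuclideanSpace ℝ (Fin n) × EuclideanSpace ℝ (Fin n) → ℝ := fun z => ⟪gradient u z.1, gradient v z.2⟫ with hH
  have mH : Measurable H := by rw [hH]; fun_prop
  have e1 : ∫ q, Real.sin q.1 * ⟪gradient u (cgT n q), gradient v q.2.1⟫ ∂(cgmu n) =
      ∫ q, (Real.sin q.1 * (‖cgT n q‖ * ‖q.2.1‖)⁻¹) *
      H (‖cgT n q‖⁻¹ • cgT n q, ‖q.2.1‖⁻¹ • q.2.1) ∂(cgmu n) := by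
    refine integral_congr_ae ?_
    filter_upwards [cg_T_ne n hn, cg_X_ne n hn] with q h1 h2
    rw [cg_grad_hom n u huh _ (inv_pos.2 (norm_pos_iff.2 h1)) _ h1,
      cg_grad_hom n v hvh _ (inv_pos.2 (norm_pos_iff.2 h2)) _ h2]
    simp only [hH, real_inner_smul_left, real_inner_smul_right, mul_inv]
    ring
  rw [e1, cg_transfer n hn H mH]
  have hint : Integrable (fun z => H z * psi n ⟪z.1, z.2⟫) ((sphereUniform n).prod (sphereUniform n)) := by
    refine (cgPsi_integrable n hn).bdd_mul (c := C * D) mH.aestronglyMeasurable ?_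
    have a := Measure.quasiMeasurePreserving_fst (μ := sphereUniform n) (ν := sphereUniform n) |>.ae (cg_sphere_norm n hn)
    have b := Measure.quasiMeasurePreserving_snd (μ := sphereUniform n) (ν := sphereUniform n) |>.ae (cg_sphere_norm n hn)
    filter_upwards [a, b] with z h1 h2
    have k1 := hC z.1 (fun h => by simp [h] at h1)
    have k2 := hD z.2 (fun h => by simp [h] at h2)
    rw [h1, inv_one, mul_one] at k1
    rw [h2, inv_one, mul_one] at k2
    refine (norm_inner_le_norm _ _).trans ?_
    gcongr
  rw [integral_prod _ hint]
end

section
/- Define ψ_3(α) = (1/(2 Γ(3/2)²)) ∫₀¹ (1-t²)^{1/2} [∫₀^∞∫₀^∞ exp(-(r² + r'² - 2rr't α)/2) rr' dr dr'] dt. Then there exist absolute constants 0 < a ≤ b such that a · log(1/(1-α)) ≤ ψ_3(α) ≤ b · log(1/(1-α)) for all α ∈ [1/2, 1). -/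
open MeasureTheory Real

/-- The mixing density `ψ₃(α)` on `S² ⊂ ℝ³`. -/
noncomputable def psiThree (α : ℝ) : ℝ :=
  (1 / (2 * Real.Gamma (3 / 2) ^ 2)) *
    ∫ t in Set.Ioo (0 : ℝ) 1,
      (1 - t ^ 2) ^ ((1 : ℝ) / 2) *
        ∫ r in Set.Ioi (0 : ℝ), ∫ r' in Set.Ioi (0 : ℝ),
          Real.exp (-(r ^ 2 + r' ^ 2 - 2 * r * r' * t * α) / 2) * (r * r')

lemma gau_int (m : ℝ) : Integrable (fun x : ℝ => Real.exp (-(x - m) ^ 2 / 2)) := by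
  have h := (integrable_exp_neg_mul_sq (b := 1 / 2) (by norm_num)).comp_sub_right m
  refine h.congr (Filter.Eventually.of_forall fun x => ?_)
  simp only []
  congr 1; ring

lemma gau_int' (m : ℝ) : Integrable (fun x : ℝ => (x - m) * Real.exp (-(x - m) ^ 2 / 2)) := by
  have h := (integrable_mul_exp_neg_mul_sq (b := 1 / 2) (by norm_num)).comp_sub_right m
  refine h.congr (Filter.Eventually.of_forall fun x => ?_)
  simp only []
  congr 2; ring

lemma gau_first (m : ℝ) : ∫ x in Set.Ioi (0 : ℝ), (x - m) * Real.exp (-(x - m) ^ 2 / 2)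
    = Real.exp (-m ^ 2 / 2) := by
  have h := integral_Ioi_of_hasDerivAt_of_tendsto' (a := 0) (m := 0)
    (f := fun x : ℝ => -Real.exp (-(x - m) ^ 2 / 2))
    (f' := fun x => (x - m) * Real.exp (-(x - m) ^ 2 / 2)) ?_ (gau_int' m).integrableOn ?_
  · rw [h]; simp
  · intro x _
    have h1 : HasDerivAt (fun x : ℝ => -(x - m) ^ 2 / 2) (-(x - m)) x := by
      have := ((((hasDerivAt_id x).sub_const m).pow 2).neg).div_const 2
      exact this.congr_deriv (by simp; ring)
    exact h1.exp.neg.congr_deriv (by ring)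
  · rw [← neg_zero]
    refine Filter.Tendsto.neg ?_
    refine Real.tendsto_exp_atBot.comp ?_
    have h1 : Filter.Tendsto (fun x : ℝ => (x - m) ^ 2 / 2) Filter.atTop Filter.atTop := by
      refine Filter.Tendsto.atTop_div_const (by norm_num) ?_
      refine (Filter.tendsto_pow_atTop (by norm_num)).comp ?_
      exact Filter.tendsto_atTop_add_const_right _ (-m) Filter.tendsto_id
    have := Filter.tendsto_neg_atTop_atBot.comp h1
    refine this.congr fun x => ?_
    simp only [Function.comp]; ring

lemma gau_total : 0 < ∫ x : ℝ, Real.exp (-x ^ 2 / 2) := by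
  have h := integral_gaussian (1 / 2)
  have e : (fun x : ℝ => Real.exp (-x ^ 2 / 2)) = fun x => Real.exp (-(1 / 2) * x ^ 2) := by
    funext x; congr 1; ring
  rw [e, h]; positivity

lemma gau_half : 0 < ∫ x in Set.Ioi (0 : ℝ), Real.exp (-x ^ 2 / 2) := by
  have h := integral_gaussian_Ioi (1 / 2)
  have e : (fun x : ℝ => Real.exp (-x ^ 2 / 2)) = fun x => Real.exp (-(1 / 2) * x ^ 2) := by
    funext x; congr 1; ring
  rw [e, h]; positivity

lemma G_bounds (m : ℝ) (hm : 0 ≤ m) :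
    m * (∫ x in Set.Ioi (0 : ℝ), Real.exp (-x ^ 2 / 2)) ≤
      ∫ x in Set.Ioi (0 : ℝ), Real.exp (-(x - m) ^ 2 / 2) * x ∧
    ∫ x in Set.Ioi (0 : ℝ), Real.exp (-(x - m) ^ 2 / 2) * x ≤
      1 + m * ∫ x : ℝ, Real.exp (-x ^ 2 / 2) := by
  have e : ∫ x in Set.Ioi (0 : ℝ), Real.exp (-(x - m) ^ 2 / 2) * x =
      Real.exp (-m ^ 2 / 2) + m * ∫ x in Set.Ioi (0 : ℝ), Real.exp (-(x - m) ^ 2 / 2) := by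
    rw [← gau_first, ← integral_const_mul, ← integral_add (gau_int' m).integrableOn
      ((gau_int m).const_mul m).integrableOn]
    congr 1; funext x; ring
  have h1 : ∫ x in Set.Ioi (0 : ℝ), Real.exp (-(x - m) ^ 2 / 2) ≤
      ∫ x : ℝ, Real.exp (-x ^ 2 / 2) := by
    rw [← integral_sub_right_eq_self (fun x : ℝ => Real.exp (-x ^ 2 / 2)) m]
    exact setIntegral_le_integral (gau_int m) (Filter.Eventually.of_forall fun x => by positivity)
  have h2 : ∫ x in Set.Ioi (0 : ℝ), Real.exp (-x ^ 2 / 2) ≤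
      ∫ x in Set.Ioi (0 : ℝ), Real.exp (-(x - m) ^ 2 / 2) := by
    have h3 : ∫ x in Set.Ioi (m : ℝ), Real.exp (-(x - m) ^ 2 / 2) =
      ∫ x in Set.Ioi (0 : ℝ), Real.exp (-x ^ 2 / 2) := by
      have := (measurePreserving_sub_right volume m).setIntegral_preimage_emb
        (MeasurableEquiv.subRight m).measurableEmbedding
        (fun x : ℝ => Real.exp (-x ^ 2 / 2)) (Set.Ioi 0)
      simpa using this
    rw [← h3]
    exact setIntegral_mono_set (gau_int m).integrableOn
      (Filter.Eventually.of_forall fun x => by positivity)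
      (Filter.Eventually.of_forall (Set.Ioi_subset_Ioi hm))
  have h4 : Real.exp (-m ^ 2 / 2) ≤ 1 := Real.exp_le_one_iff.2 (by nlinarith)
  rw [e]
  constructor
  · have := mul_le_mul_of_nonneg_left h2 hm
    have := Real.exp_pos (-m ^ 2 / 2)
    linarith
  · have := mul_le_mul_of_nonneg_left h1 hm
    linarith

lemma inner_eq (r s : ℝ) :
    ∫ r' in Set.Ioi (0 : ℝ), Real.exp (-(r ^ 2 + r' ^ 2 - 2 * r * r' * s) / 2) * (r * r') =
      r * Real.exp (-((1 - s ^ 2) / 2) * r ^ 2) *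
        ∫ x in Set.Ioi (0 : ℝ), Real.exp (-(x - r * s) ^ 2 / 2) * x := by
  rw [← integral_const_mul]
  congr 1; funext x
  have : -(r ^ 2 + x ^ 2 - 2 * r * x * s) / 2 =
    -((1 - s ^ 2) / 2) * r ^ 2 + -(x - r * s) ^ 2 / 2 := by ring
  rw [this, Real.exp_add]; ring

lemma mom_one (b : ℝ) (hb : 0 < b) :
    IntegrableOn (fun r : ℝ => r * Real.exp (-b * r ^ 2)) (Set.Ioi 0) ∧
    ∫ r in Set.Ioi (0 : ℝ), r * Real.exp (-b * r ^ 2) = b ^ (-1 : ℝ) / 2 := by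
  refine ⟨(integrable_mul_exp_neg_mul_sq hb).integrableOn, ?_⟩
  have h := integral_rpow_mul_exp_neg_mul_rpow (p := 2) (q := 1) (b := b) (by norm_num)
    (by norm_num) hb
  norm_num at h
  norm_num
  rw [h, Real.rpow_neg_one]; ring

lemma mom_two (b : ℝ) (hb : 0 < b) :
    IntegrableOn (fun r : ℝ => r ^ 2 * Real.exp (-b * r ^ 2)) (Set.Ioi 0) ∧
    ∫ r in Set.Ioi (0 : ℝ), r ^ 2 * Real.exp (-b * r ^ 2) =
      b ^ (-(3 / 2) : ℝ) / 2 * Real.Gamma (3 / 2) := by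
  constructor
  · have := (integrable_rpow_mul_exp_neg_mul_sq hb (s := 2) (by norm_num)).integrableOn (s := Set.Ioi 0)
    simpa using this
  have h := integral_rpow_mul_exp_neg_mul_rpow (p := 2) (q := 2) (b := b) (by norm_num)
    (by norm_num) hb
  norm_num at h
  norm_num
  rw [h]; ring

/-- inner double integral -/
noncomputable def FF (s : ℝ) : ℝ := ∫ r in Set.Ioi (0 : ℝ), ∫ r' in Set.Ioi (0 : ℝ),
          Real.exp (-(r ^ 2 + r' ^ 2 - 2 * r * r' * s) / 2) * (r * r')

lemma meas_inner : StronglyMeasurable (fun p : ℝ × ℝ => ∫ r' in Set.Ioi (0 : ℝ),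
          Real.exp (-(p.2 ^ 2 + r' ^ 2 - 2 * p.2 * r' * p.1) / 2) * (p.2 * r')) := by
  refine StronglyMeasurable.integral_prod_right'
    (f := fun q : (ℝ × ℝ) × ℝ => Real.exp (-(q.1.2 ^ 2 + q.2 ^ 2 - 2 * q.1.2 * q.2 * q.1.1) / 2) * (q.1.2 * q.2)) ?_
  exact Continuous.stronglyMeasurable (by fun_prop)

lemma meas_FF : StronglyMeasurable FF :=
  StronglyMeasurable.integral_prod_right' (f := fun p : ℝ × ℝ => ∫ r' in Set.Ioi (0 : ℝ),
          Real.exp (-(p.2 ^ 2 + r' ^ 2 - 2 * p.2 * r' * p.1) / 2) * (p.2 * r')) meas_inner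

lemma FF_bounds : ∃ c C : ℝ, 0 < c ∧ 0 < C ∧ ∀ s : ℝ, 0 ≤ s → s < 1 →
    c * s * (1 - s ^ 2) ^ (-(3 / 2) : ℝ) ≤ FF s ∧ FF s ≤ C * (1 - s ^ 2) ^ (-(3 / 2) : ℝ) := by
  set T := ∫ x : ℝ, Real.exp (-x ^ 2 / 2) with hT
  set H := ∫ x in Set.Ioi (0 : ℝ), Real.exp (-x ^ 2 / 2) with hH
  have hTp : 0 < T := gau_total
  have hHp : 0 < H := gau_half
  have hG : 0 < Real.Gamma (3 / 2) := Real.Gamma_pos_of_pos (by norm_num)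
  set k : ℝ := (1 / 2 : ℝ) ^ (-(3 / 2) : ℝ) with hk
  have hkp : 0 < k := by positivity
  refine ⟨H * (k / 2 * Real.Gamma (3 / 2)), 1 + T * (k / 2 * Real.Gamma (3 / 2)), by positivity,
    by positivity, ?_⟩
  intro s hs0 hs1
  have hβ : 0 < 1 - s ^ 2 := by nlinarith
  have hb : 0 < (1 - s ^ 2) / 2 := by linarith
  obtain ⟨i1, v1⟩ := mom_one _ hb
  obtain ⟨i2, v2⟩ := mom_two _ hb
  have hb32 : ((1 - s ^ 2) / 2) ^ (-(3 / 2) : ℝ) = k * (1 - s ^ 2) ^ (-(3 / 2) : ℝ) := by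
    rw [hk, ← Real.mul_rpow (by norm_num) hβ.le]; congr 1; ring
  have hb1 : ((1 - s ^ 2) / 2) ^ (-1 : ℝ) / 2 ≤ (1 - s ^ 2) ^ (-(3 / 2) : ℝ) := by
    have : ((1 - s ^ 2) / 2) ^ (-1 : ℝ) / 2 = (1 - s ^ 2) ^ (-1 : ℝ) := by
      rw [Real.rpow_neg_one, Real.rpow_neg_one]; field_simp
    rw [this]
    exact Real.rpow_le_rpow_of_exponent_ge hβ (by nlinarith) (by norm_num)
  have iU : IntegrableOn (fun r : ℝ => r * Real.exp (-((1 - s ^ 2) / 2) * r ^ 2) +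
      T * (r ^ 2 * Real.exp (-((1 - s ^ 2) / 2) * r ^ 2))) (Set.Ioi 0) := i1.add (i2.const_mul T)
  have hup : ∀ r ∈ Set.Ioi (0 : ℝ), (∫ r' in Set.Ioi (0 : ℝ),
      Real.exp (-(r ^ 2 + r' ^ 2 - 2 * r * r' * s) / 2) * (r * r')) ≤
      r * Real.exp (-((1 - s ^ 2) / 2) * r ^ 2) +
      T * (r ^ 2 * Real.exp (-((1 - s ^ 2) / 2) * r ^ 2)) := by
    intro r hr
    have hr : 0 < r := hr
    rw [inner_eq]
    have h := (G_bounds (r * s) (by positivity)).2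
    have h' : 1 + r * s * T ≤ 1 + r * T := by
      have : r * s * T ≤ r * 1 * T := by gcongr
      linarith
    calc _ ≤ r * Real.exp (-((1 - s ^ 2) / 2) * r ^ 2) * (1 + r * T) := by
          apply mul_le_mul_of_nonneg_left (h.trans h') (by positivity)
      _ = _ := by ring
  have hlo : ∀ r ∈ Set.Ioi (0 : ℝ), (H * s) * (r ^ 2 * Real.exp (-((1 - s ^ 2) / 2) * r ^ 2)) ≤
      (∫ r' in Set.Ioi (0 : ℝ),
      Real.exp (-(r ^ 2 + r' ^ 2 - 2 * r * r' * s) / 2) * (r * r')) := by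
    intro r hr
    have hr : 0 < r := hr
    rw [inner_eq]
    have h := (G_bounds (r * s) (by positivity)).1
    calc _ = r * Real.exp (-((1 - s ^ 2) / 2) * r ^ 2) * (r * s * H) := by ring
      _ ≤ _ := by
          apply mul_le_mul_of_nonneg_left h (by positivity)
  have iF : IntegrableOn (fun r : ℝ => ∫ r' in Set.Ioi (0 : ℝ),
      Real.exp (-(r ^ 2 + r' ^ 2 - 2 * r * r' * s) / 2) * (r * r')) (Set.Ioi 0) := by
    refine Integrable.mono' iU ?_ ?_
    · exact (meas_inner.comp_measurable (measurable_prodMk_left (x := s))).aestronglyMeasurable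
    · refine (ae_restrict_iff' measurableSet_Ioi).2 (Filter.Eventually.of_forall fun r hr => ?_)
      rw [Real.norm_of_nonneg]
      · exact hup r hr
      · exact le_trans (by positivity) (hlo r hr)
  constructor
  · have := setIntegral_mono_on (i2.const_mul (H * s)) iF measurableSet_Ioi hlo
    rw [integral_const_mul, v2, hb32] at this
    calc _ = _ := by ring
      _ ≤ _ := this
  · have := setIntegral_mono_on iF iU measurableSet_Ioi hup
    rw [integral_add i1 (i2.const_mul T), integral_const_mul, v1, v2, hb32] at this
    refine this.trans ?_
    nlinarith

lemma up_int (α : ℝ) (h1 : 1 / 2 ≤ α) (h2 : α < 1) :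
    IntegrableOn (fun t : ℝ => 1 / (1 - t * α)) (Set.Ioo 0 1) ∧
    ∫ t in Set.Ioo (0 : ℝ) 1, 1 / (1 - t * α) = Real.log (1 / (1 - α)) / α := by
  have hd : ∀ t ∈ Set.uIcc (0 : ℝ) 1, 1 - t * α ≠ 0 := by
    intro t ht
    rw [Set.uIcc_of_le (by norm_num)] at ht
    have := ht.1; have := ht.2
    nlinarith
  have hc : ContinuousOn (fun t : ℝ => 1 / (1 - t * α)) (Set.uIcc 0 1) :=
    continuousOn_const.div (by fun_prop) hd
  have hi := hc.intervalIntegrable (μ := volume)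
  constructor
  · exact ((intervalIntegrable_iff_integrableOn_Ioc_of_le (by norm_num)).1 hi).mono_set
      Set.Ioo_subset_Ioc_self
  · rw [← integral_Ioc_eq_integral_Ioo, ← intervalIntegral.integral_of_le (by norm_num)]
    rw [intervalIntegral.integral_eq_sub_of_hasDerivAt (f := fun t => -Real.log (1 - t * α) / α) _ hi]
    · simp; 
    · intro t ht
      have h := hd t ht
      have h3 : HasDerivAt (fun t : ℝ => 1 - t * α) (-α) t := by
        simpa using ((hasDerivAt_id t).mul_const α).const_sub 1
      have hα : α ≠ 0 := by linarith
      exact ((h3.log h).neg.div_const α).congr_deriv (by field_simp)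

lemma lo_int (α : ℝ) (h1 : 1 / 2 ≤ α) (h2 : α < 1) :
    IntegrableOn (fun t : ℝ => t / (1 - t)) (Set.Ioo 0 α) ∧
    ∫ t in Set.Ioo (0 : ℝ) α, t / (1 - t) = Real.log (1 / (1 - α)) - α := by
  have hd : ∀ t ∈ Set.uIcc (0 : ℝ) α, 1 - t ≠ 0 := by
    intro t ht
    rw [Set.uIcc_of_le (by linarith)] at ht
    have := ht.1; have := ht.2
    linarith
  have hc : ContinuousOn (fun t : ℝ => t / (1 - t)) (Set.uIcc 0 α) :=
    continuousOn_id.div (by fun_prop) hd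
  have hi := hc.intervalIntegrable (μ := volume)
  constructor
  · exact ((intervalIntegrable_iff_integrableOn_Ioc_of_le (by linarith)).1 hi).mono_set
      Set.Ioo_subset_Ioc_self
  · rw [← integral_Ioc_eq_integral_Ioo, ← intervalIntegral.integral_of_le (by linarith)]
    rw [intervalIntegral.integral_eq_sub_of_hasDerivAt (f := fun t => -Real.log (1 - t) - t) _ hi]
    · simp
    · intro t ht
      have h := hd t ht
      have h3 : HasDerivAt (fun t : ℝ => 1 - t) (-1) t := by
        simpa using (hasDerivAt_id t).const_sub 1
      exact ((h3.log h).neg.sub (hasDerivAt_id t)).congr_deriv (by field_simp; ring)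

lemma log_lo (α : ℝ) (h1 : 1 / 2 ≤ α) (h2 : α < 1) :
    (1 / 4) * Real.log (1 / (1 - α)) ≤ Real.log (1 / (1 - α)) - α := by
  have h3 : 0 < 1 - α := by linarith
  have h := Real.le_log_one_add_of_nonneg (x := α / (1 - α)) (by positivity)
  have e : 1 + α / (1 - α) = 1 / (1 - α) := by field_simp; ring
  have e2 : 2 * (α / (1 - α)) / (α / (1 - α) + 2) = 2 * α / (2 - α) := by
    have : 2 - α ≠ 0 := by linarith
    have : α + 2 * (1 - α) ≠ 0 := by linarith
    field_simp; ring
  rw [e, e2] at h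
  have : 4 / 3 * α ≤ 2 * α / (2 - α) := by
    rw [le_div_iff₀ (by linarith)]; nlinarith
  linarith

lemma pw_mul {q : ℝ} (hq : 0 < q) : q ^ ((1 : ℝ) / 2) * q ^ (-(3 / 2) : ℝ) = 1 / q := by
  rw [← Real.rpow_add hq]; norm_num [Real.rpow_neg_one]

set_option maxHeartbeats 2000000 in
/-- `ψ₃(α) ∼ log(1/(1-α))` on `[1/2, 1)` with absolute constants. -/
theorem statement8 :
    ∃ a b : ℝ, 0 < a ∧ a ≤ b ∧ ∀ α : ℝ, 1 / 2 ≤ α → α < 1 →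
      a * Real.log (1 / (1 - α)) ≤ psiThree α ∧
        psiThree α ≤ b * Real.log (1 / (1 - α)) := by
  obtain ⟨c, C, hc, hC, hF⟩ := FF_bounds
  have hG : 0 < Real.Gamma (3 / 2) := Real.Gamma_pos_of_pos (by norm_num)
  set K : ℝ := 1 / (2 * Real.Gamma (3 / 2) ^ 2) with hK
  have hKp : 0 < K := by positivity
  set k4 : ℝ := (4 : ℝ) ^ (-(3 / 2) : ℝ) with hk4
  have hk4p : 0 < k4 := by positivity
  set k2 : ℝ := (2 : ℝ) ^ ((1 : ℝ) / 2) with hk2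
  have hk2p : 0 < k2 := by positivity
  set a : ℝ := K * (c * k4 / 2 * (1 / 4)) with ha
  set b : ℝ := K * (C * k2 * 2) with hb
  refine ⟨a, max a b, by positivity, le_max_left _ _, ?_⟩
  intro α h1 h2
  have hL : 0 ≤ Real.log (1 / (1 - α)) := by
    apply Real.log_nonneg
    rw [le_div_iff₀ (by linarith)]; linarith
  have hpsi : psiThree α = K * ∫ t in Set.Ioo (0 : ℝ) 1,
      (1 - t ^ 2) ^ ((1 : ℝ) / 2) * FF (t * α) := by
    unfold psiThree FF
    simp only [mul_assoc, hK]
  obtain ⟨iu, vu⟩ := up_int α h1 h2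
  obtain ⟨il, vl⟩ := lo_int α h1 h2
  have hnn : ∀ t ∈ Set.Ioo (0 : ℝ) 1, 0 ≤ (1 - t ^ 2) ^ ((1 : ℝ) / 2) * FF (t * α) := by
    rintro t ⟨t0, t1⟩
    have hs0 : 0 ≤ t * α := by nlinarith
    have hs1 : t * α < 1 := by nlinarith
    have h := (hF (t * α) hs0 hs1).1
    have : 0 < 1 - (t * α) ^ 2 := by nlinarith
    have : 0 < 1 - t ^ 2 := by nlinarith
    have h' : 0 ≤ FF (t * α) := le_trans (by positivity) h
    positivity
  have hup : ∀ t ∈ Set.Ioo (0 : ℝ) 1, (1 - t ^ 2) ^ ((1 : ℝ) / 2) * FF (t * α) ≤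
      C * k2 * (1 / (1 - t * α)) := by
    rintro t ⟨t0, t1⟩
    have hs0 : 0 ≤ t * α := by nlinarith
    have hs1 : t * α < 1 := by nlinarith
    have h := (hF (t * α) hs0 hs1).2
    have hq : 0 < 1 - t * α := by linarith
    have e1 : (1 - t ^ 2) ^ ((1 : ℝ) / 2) ≤ k2 * (1 - t * α) ^ ((1 : ℝ) / 2) := by
      rw [hk2, ← Real.mul_rpow (by norm_num) hq.le]
      exact Real.rpow_le_rpow (by nlinarith) (by nlinarith) (by norm_num)
    have e2 : (1 - (t * α) ^ 2) ^ (-(3 / 2) : ℝ) ≤ (1 - t * α) ^ (-(3 / 2) : ℝ) :=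
      Real.rpow_le_rpow_of_nonpos hq (by nlinarith) (by norm_num)
    have h0 : 0 ≤ C * (1 - t * α) ^ (-(3 / 2) : ℝ) := by positivity
    calc (1 - t ^ 2) ^ ((1 : ℝ) / 2) * FF (t * α)
        ≤ (1 - t ^ 2) ^ ((1 : ℝ) / 2) * (C * (1 - t * α) ^ (-(3 / 2) : ℝ)) := by
          apply mul_le_mul_of_nonneg_left (h.trans (mul_le_mul_of_nonneg_left e2 hC.le))
          exact Real.rpow_nonneg (by nlinarith) _
      _ ≤ (k2 * (1 - t * α) ^ ((1 : ℝ) / 2)) * (C * (1 - t * α) ^ (-(3 / 2) : ℝ)) :=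
          mul_le_mul_of_nonneg_right e1 h0
      _ = C * k2 * ((1 - t * α) ^ ((1 : ℝ) / 2) * (1 - t * α) ^ (-(3 / 2) : ℝ)) := by ring
      _ = _ := by rw [pw_mul hq]
  have hlo : ∀ t ∈ Set.Ioo (0 : ℝ) α, c * k4 / 2 * (t / (1 - t)) ≤
      (1 - t ^ 2) ^ ((1 : ℝ) / 2) * FF (t * α) := by
    rintro t ⟨t0, t1⟩
    have hs0 : 0 ≤ t * α := by nlinarith
    have hs1 : t * α < 1 := by nlinarith
    have h := (hF (t * α) hs0 hs1).1
    have hq : 0 < 1 - t := by linarith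
    have e1 : (1 - t) ^ ((1 : ℝ) / 2) ≤ (1 - t ^ 2) ^ ((1 : ℝ) / 2) :=
      Real.rpow_le_rpow hq.le (by nlinarith) (by norm_num)
    have q1 : 1 - t * α ≤ 2 * (1 - t) := by nlinarith
    have q2 : 1 - (t * α) ^ 2 ≤ 4 * (1 - t) := by
      have : 1 - (t * α) ^ 2 ≤ 2 * (1 - t * α) := by nlinarith [sq_nonneg (1 - t * α)]
      linarith
    have q3 : 0 < 1 - (t * α) ^ 2 := by
      have : (t * α) ^ 2 ≤ t * α := by nlinarith
      linarith
    have e2 : k4 * (1 - t) ^ (-(3 / 2) : ℝ) ≤ (1 - (t * α) ^ 2) ^ (-(3 / 2) : ℝ) := by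
      rw [hk4, ← Real.mul_rpow (by norm_num) hq.le]
      exact Real.rpow_le_rpow_of_nonpos q3 q2 (by norm_num)
    have h3 : (c * (t / 2)) * (k4 * (1 - t) ^ (-(3 / 2) : ℝ)) ≤ FF (t * α) := by
      refine le_trans ?_ h
      have q4 : t / 2 ≤ t * α := by nlinarith
      refine mul_le_mul ?_ e2 (by positivity) (by positivity)
      exact mul_le_mul_of_nonneg_left q4 hc.le
    calc _ = (c * k4 / 2 * t) * (1 / (1 - t)) := by ring
      _ = (1 - t) ^ ((1 : ℝ) / 2) * ((c * (t / 2)) * (k4 * (1 - t) ^ (-(3 / 2) : ℝ))) := by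
          rw [← pw_mul hq]; ring
      _ ≤ _ := mul_le_mul e1 h3 (by positivity) (Real.rpow_nonneg (by nlinarith) _)
  have iI : IntegrableOn (fun t : ℝ => (1 - t ^ 2) ^ ((1 : ℝ) / 2) * FF (t * α))
      (Set.Ioo 0 1) := by
    refine Integrable.mono' (iu.const_mul (C * k2)) ?_ ?_
    · have m1 : Measurable (fun t : ℝ => (1 - t ^ 2) ^ ((1 : ℝ) / 2)) := by fun_prop
      have m2 : Measurable (fun t : ℝ => FF (t * α)) :=
        meas_FF.measurable.comp (measurable_id.mul_const α)
      exact (m1.mul m2).aestronglyMeasurable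
    · refine (ae_restrict_iff' measurableSet_Ioo).2 (Filter.Eventually.of_forall fun t ht => ?_)
      rw [Real.norm_of_nonneg (hnn t ht)]
      exact hup t ht
  have hsub : Set.Ioo (0 : ℝ) α ⊆ Set.Ioo 0 1 := Set.Ioo_subset_Ioo_right h2.le
  rw [hpsi]
  constructor
  · have g1 := setIntegral_mono_on (il.const_mul (c * k4 / 2)) (iI.mono_set hsub)
      measurableSet_Ioo hlo
    have g2 := setIntegral_mono_set iI ((ae_restrict_iff' measurableSet_Ioo).2
      (Filter.Eventually.of_forall hnn)) (Filter.Eventually.of_forall hsub)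
    rw [integral_const_mul, vl] at g1
    have g3 := mul_le_mul_of_nonneg_left (log_lo α h1 h2) (by positivity : 0 ≤ c * k4 / 2)
    rw [ha, mul_assoc]
    apply mul_le_mul_of_nonneg_left _ hKp.le
    calc _ = _ := by ring
      _ ≤ _ := (g3.trans g1).trans g2
  · have g1 := setIntegral_mono_on iI (iu.const_mul (C * k2)) measurableSet_Ioo hup
    rw [integral_const_mul, vu] at g1
    have g2 : Real.log (1 / (1 - α)) / α ≤ 2 * Real.log (1 / (1 - α)) := by
      rw [div_le_iff₀ (by linarith)]; nlinarith
    have g3 := mul_le_mul_of_nonneg_left g2 (by positivity : 0 ≤ C * k2)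
    refine le_trans ?_ (mul_le_mul_of_nonneg_right (le_max_right a b) hL)
    rw [hb, mul_assoc]
    apply mul_le_mul_of_nonneg_left _ hKp.le
    calc _ ≤ _ := g1.trans g3
      _ = _ := by ring
end

section
/- Define ψ_2(α) = ∫₀¹ ∫₀^∞ ∫₀^∞ exp(-(r² + r'² - 2rr't α)/2) dr dr' dt for α ∈ [-1,1]. Then ψ_2(α) ≤ 2π for all α, the constant c₂ = ∫_{S¹}∫_{S¹} ψ_2(⟨x,y⟩) dσ₁(x) dσ₁(y) satisfies c₂ < π, and for all continuously differentiable 0-homogeneous functions u, v : ℝ²\{0} → ℝ one has cov_{σ₁}(u,v) = ∫_{S¹}∫_{S¹} ⟨∇u(x), ∇v(y)⟩ ψ_2(⟨x,y⟩) dσ₁(x) dσ₁(y). -/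
open MeasureTheory Real
open scoped RealInnerProductSpace

/-- The mixing density `ψ₂(α)` on the circle. -/
noncomputable def psiTwo (α : ℝ) : ℝ :=
  ∫ t in Set.Ioo (0 : ℝ) 1,
    ∫ r in Set.Ioi (0 : ℝ), ∫ r' in Set.Ioi (0 : ℝ),
      Real.exp (-(r ^ 2 + r' ^ 2 - 2 * r * r' * t * α) / 2)


namespace CovCircle

abbrev E2 := EuclideanSpace ℝ (Fin 2)

noncomputable def e (a : ℝ) : E2 := !₂[cos a, sin a]

lemma e_cont : Continuous e := by
  unfold e
  refine (PiLp.continuous_toLp 2 _).comp ?_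
  refine continuous_pi fun i => ?_
  fin_cases i
  · exact continuous_cos
  · exact continuous_sin

lemma e_periodic : Function.Periodic e (2 * π) := by
  intro a; simp [e]

lemma inner_e (a b : ℝ) : ⟪e a, e b⟫ = cos (a - b) := by
  simp [e, PiLp.inner_apply, Fin.sum_univ_two, cos_sub]; ring

lemma norm_e (a : ℝ) : ‖e a‖ = 1 := by
  simp [e, EuclideanSpace.norm_eq, Fin.sum_univ_two]

lemma lint_r : ∫⁻ r in Set.Ioi (0 : ℝ), ENNReal.ofReal (r * Real.exp (-r ^ 2 / 2)) = 1 := by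
  have hd : ∀ x ∈ Set.Ici (0:ℝ), HasDerivAt (fun r : ℝ => -Real.exp (-r ^ 2 / 2))
      (x * Real.exp (-x ^ 2 / 2)) x := by
    intro x _
    have h : HasDerivAt (fun r : ℝ => -r ^ 2 / 2) (-x) x := by
      refine (((hasDerivAt_pow 2 x).neg).div_const 2).congr_deriv ?_
      simp; ring
    refine (h.exp).neg.congr_deriv ?_
    ring
  have hp : ∀ x ∈ Set.Ioi (0:ℝ), 0 ≤ x * Real.exp (-x ^ 2 / 2) := fun x hx =>
    mul_nonneg (le_of_lt hx) (exp_pos _).le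
  have ht : Filter.Tendsto (fun r : ℝ => -Real.exp (-r ^ 2 / 2)) Filter.atTop (nhds 0) := by
    have : Filter.Tendsto (fun r : ℝ => Real.exp (-r ^ 2 / 2)) Filter.atTop (nhds 0) := by
      refine tendsto_exp_atBot.comp ?_
      have h2 : Filter.Tendsto (fun r : ℝ => r ^ 2 / 2) Filter.atTop Filter.atTop :=
        (Filter.tendsto_pow_atTop (by norm_num)).atTop_div_const (by norm_num)
      refine (Filter.tendsto_neg_atTop_atBot.comp h2).congr fun r => ?_
      simp [neg_div]
    simpa using this.neg
  have hi := integrableOn_Ioi_deriv_of_nonneg' hd hp ht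
  have hv := integral_Ioi_of_hasDerivAt_of_nonneg' hd hp ht
  rw [← ofReal_integral_eq_lintegral_ofReal hi, hv]
  · simp
  · exact (ae_restrict_iff' measurableSet_Ioi).2 (Filter.Eventually.of_forall hp)

noncomputable def toE : ℝ × ℝ ≃ᵐ E2 :=
  (MeasurableEquiv.finTwoArrow (α := ℝ)).symm.trans (MeasurableEquiv.toLp 2 (Fin 2 → ℝ))

lemma toE_mp : MeasurePreserving toE volume volume :=
  ((volume_preserving_finTwoArrow ℝ).symm _).trans
    (PiLp.volume_preserving_toLp (Fin 2))

lemma toE_polar (p : ℝ × ℝ) : toE (polarCoord.symm p) = p.1 • e p.2 := by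
  ext i
  fin_cases i <;> simp [toE, e, MeasurableEquiv.finTwoArrow]

lemma sphere_apply (S : Set E2) (hS : MeasurableSet S) :
    sphereUniform 2 S = ENNReal.ofReal (2 * π)⁻¹ * volume.restrict (Set.Ioo (-π) π) (e ⁻¹' S) := by
  have hm : Measurable (fun x : E2 => ‖x‖⁻¹ • x) := by fun_prop
  have hS' := hm hS
  rw [sphereUniform, Measure.map_apply hm hS, stdGaussian, withDensity_apply _ hS',
    ← lintegral_indicator hS', ← toE_mp.lintegral_comp_emb toE.measurableEmbedding,
    ← lintegral_comp_polarCoord_symm]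
  have h1 : ∀ p ∈ polarCoord.target, ENNReal.ofReal p.1 •
      (((fun x : E2 => ‖x‖⁻¹ • x) ⁻¹' S).indicator (fun x =>
        ENNReal.ofReal ((2 * π) ^ (-((2 : ℕ) : ℝ) / 2) * Real.exp (-‖x‖ ^ 2 / 2))))
          (toE (polarCoord.symm p)) =
      ENNReal.ofReal (p.1 * Real.exp (-p.1 ^ 2 / 2)) *
        (e ⁻¹' S).indicator (fun _ => ENNReal.ofReal (2 * π)⁻¹) p.2 := by
    rintro ⟨r, a⟩ ⟨hr, ha⟩
    have hr : 0 < r := hr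
    rw [toE_polar]
    have hn : ‖r • e a‖ = r := by rw [norm_smul, norm_e, Real.norm_of_nonneg hr.le, mul_one]
    have hc : (2 * π) ^ (-((2 : ℕ) : ℝ) / 2) = (2 * π)⁻¹ := by
      rw [← Real.rpow_neg_one]; norm_num
    by_cases h : e a ∈ S
    · rw [Set.indicator_of_mem, Set.indicator_of_mem]
      · simp only [hn, hc, smul_eq_mul]
        rw [← ENNReal.ofReal_mul hr.le, ← ENNReal.ofReal_mul (by positivity)]
        congr 1; ring
      · exact h
      · simp only [Set.mem_preimage, hn, smul_smul, inv_mul_cancel₀ hr.ne', one_smul]; exact h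
    · rw [Set.indicator_of_notMem, Set.indicator_of_notMem]
      · simp
      · exact h
      · simp only [Set.mem_preimage, hn, smul_smul, inv_mul_cancel₀ hr.ne', one_smul]; exact h
  rw [setLIntegral_congr_fun (polarCoord.open_target.measurableSet) h1, polarCoord_target,
    Measure.volume_eq_prod, ← Measure.prod_restrict,
    lintegral_prod_mul (f := fun r => ENNReal.ofReal (r * Real.exp (-r ^ 2 / 2)))
      (g := (e ⁻¹' S).indicator (fun _ => ENNReal.ofReal (2 * π)⁻¹)), lint_r, one_mul,
    lintegral_indicator (e_cont.measurable hS), lintegral_const,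
    Measure.restrict_apply MeasurableSet.univ, Set.univ_inter]
  · exact (by fun_prop : Measurable fun r : ℝ => ENNReal.ofReal (r * Real.exp (-r ^ 2 / 2))).aemeasurable
  · exact (measurable_const.indicator (e_cont.measurable hS)).aemeasurable

lemma sphere_eq : sphereUniform 2 =
    ENNReal.ofReal (2 * π)⁻¹ • (volume.restrict (Set.Ioo (-π) π)).map e := by
  ext S hS
  rw [sphere_apply S hS, Measure.smul_apply, Measure.map_apply e_cont.measurable hS, smul_eq_mul]

lemma e_injOn : Set.InjOn e (Set.Ioo (-π) π) := by
  intro a ha b hb h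
  have h0 : cos a = cos b := by simpa [e] using congrArg (fun x : E2 => x 0) h
  have h1 : sin a = sin b := by simpa [e] using congrArg (fun x : E2 => x 1) h
  have h2 : cos (a - b) = 1 := by
    rw [cos_sub, h0, h1]; nlinarith [sin_sq_add_cos_sq b]
  have := (cos_eq_one_iff_of_lt_of_lt (by linarith [ha.1, hb.2]) (by linarith [ha.2, hb.1])).1 h2
  linarith

lemma sphere_int (F : E2 → ℝ) :
    ∫ x, F x ∂(sphereUniform 2) = (2 * π)⁻¹ * ∫ a in (0:ℝ)..(2 * π), F (e a) := by
  have hI : MeasurableSet (Set.Ioo (-π) π) := measurableSet_Ioo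
  have : PolishSpace (Set.Ioo (-π) π) := isOpen_Ioo.polishSpace
  have hemb : MeasurableEmbedding (fun a : Set.Ioo (-π) π => e a) :=
    Continuous.measurableEmbedding (e_cont.comp continuous_subtype_val)
      (fun a b h => Subtype.ext (e_injOn a.2 b.2 h))
  have key : ∫ x, F x ∂((volume.restrict (Set.Ioo (-π) π)).map e) =
      ∫ a in Set.Ioo (-π) π, F (e a) := by
    rw [← map_comap_subtype_coe hI, Measure.map_map e_cont.measurable measurable_subtype_coe]
    rw [(MeasurableEmbedding.subtype_coe hI).integral_map]
    exact hemb.integral_map _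
  rw [sphere_eq, integral_smul_measure, key, ENNReal.toReal_ofReal (by positivity), smul_eq_mul]
  congr 1
  rw [← integral_Ioc_eq_integral_Ioo, ← intervalIntegral.integral_of_le (by linarith [pi_pos])]
  have hp : Function.Periodic (fun a => F (e a)) (2 * π) := fun a => by
    simp only [e_periodic a]
  have := hp.intervalIntegral_add_eq (-π) 0
  rw [zero_add, show -π + 2 * π = π by ring] at this
  exact this


lemma lin_r {c : ℝ} (hc : 0 < c) :
    IntegrableOn (fun r : ℝ => r * Real.exp (-(c * r ^ 2) / 2)) (Set.Ioi 0) ∧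
    ∫ r in Set.Ioi (0 : ℝ), r * Real.exp (-(c * r ^ 2) / 2) = 1 / c := by
  have hd : ∀ x ∈ Set.Ici (0:ℝ), HasDerivAt (fun r : ℝ => -(Real.exp (-(c * r ^ 2) / 2) / c))
      (x * Real.exp (-(c * x ^ 2) / 2)) x := by
    intro x _
    have h : HasDerivAt (fun r : ℝ => -(c * r ^ 2) / 2) (-(c * x)) x := by
      refine ((((hasDerivAt_pow 2 x).const_mul c).neg).div_const 2).congr_deriv ?_
      simp; ring
    refine ((h.exp).div_const c).neg.congr_deriv ?_
    field_simp
  have hp : ∀ x ∈ Set.Ioi (0:ℝ), 0 ≤ x * Real.exp (-(c * x ^ 2) / 2) := fun x hx =>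
    mul_nonneg (le_of_lt hx) (exp_pos _).le
  have ht : Filter.Tendsto (fun r : ℝ => -(Real.exp (-(c * r ^ 2) / 2) / c)) Filter.atTop
      (nhds 0) := by
    have : Filter.Tendsto (fun r : ℝ => Real.exp (-(c * r ^ 2) / 2)) Filter.atTop (nhds 0) := by
      refine tendsto_exp_atBot.comp ?_
      have h2 : Filter.Tendsto (fun r : ℝ => (c * r ^ 2) / 2) Filter.atTop Filter.atTop :=
        ((Filter.tendsto_pow_atTop (by norm_num)).const_mul_atTop hc).atTop_div_const (by norm_num)
      refine (Filter.tendsto_neg_atTop_atBot.comp h2).congr fun r => ?_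
      simp [neg_div]
    simpa using (this.div_const c).neg
  refine ⟨integrableOn_Ioi_deriv_of_nonneg' hd hp ht, ?_⟩
  rw [integral_Ioi_of_hasDerivAt_of_nonneg' hd hp ht]
  simp

lemma lin_m {s : ℝ} (hs : s ∈ Set.Ioo (-1 : ℝ) 1) :
    IntegrableOn (fun m : ℝ => 1 / (1 + m ^ 2 - 2 * m * s)) (Set.Ioi 0) ∧
    ∫ m in Set.Ioi (0 : ℝ), 1 / (1 + m ^ 2 - 2 * m * s) = (π / 2 + arcsin s) / √(1 - s ^ 2) := by
  have h0 : 0 < 1 - s ^ 2 := by nlinarith [hs.1, hs.2]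
  set w := √(1 - s ^ 2) with hw
  have hwp : 0 < w := Real.sqrt_pos.2 h0
  have hw2 : w ^ 2 = 1 - s ^ 2 := Real.sq_sqrt h0.le
  have hpos : ∀ m : ℝ, 0 < 1 + m ^ 2 - 2 * m * s := fun m => by nlinarith [sq_nonneg (m - s)]
  have hd : ∀ x ∈ Set.Ici (0:ℝ), HasDerivAt (fun m : ℝ => arctan ((m - s) / w) / w)
      (1 / (1 + x ^ 2 - 2 * x * s)) x := by
    intro x _
    have h : HasDerivAt (fun m : ℝ => (m - s) / w) (1 / w) x :=
      ((hasDerivAt_id x).sub_const s).div_const w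
    refine ((h.arctan).div_const w).congr_deriv ?_
    have := hpos x
    have h3 : 1 + ((x - s) / w) ^ 2 = (1 + x ^ 2 - 2 * x * s) / w ^ 2 := by
      field_simp; rw [hw2]; ring
    rw [h3]
    field_simp
  have ht : Filter.Tendsto (fun m : ℝ => arctan ((m - s) / w) / w) Filter.atTop
      (nhds (π / 2 / w)) := by
    refine Filter.Tendsto.div_const ?_ w
    refine (tendsto_nhds_of_tendsto_nhdsWithin tendsto_arctan_atTop).comp ?_
    exact (Filter.tendsto_atTop_add_const_right _ (-s) Filter.tendsto_id).atTop_div_const hwp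
  have hp : ∀ x ∈ Set.Ioi (0:ℝ), 0 ≤ 1 / (1 + x ^ 2 - 2 * x * s) := fun x _ =>
    (one_div_pos.2 (hpos x)).le
  refine ⟨integrableOn_Ioi_deriv_of_nonneg' hd hp ht, ?_⟩
  rw [integral_Ioi_of_hasDerivAt_of_nonneg' hd hp ht, arcsin_eq_arctan hs, ← hw, zero_sub, neg_div,
    arctan_neg]
  ring

lemma double_int {s : ℝ} (hs : s ∈ Set.Ioo (-1 : ℝ) 1) :
    ∫ r in Set.Ioi (0 : ℝ), ∫ r' in Set.Ioi (0 : ℝ),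
      Real.exp (-(r ^ 2 + r' ^ 2 - 2 * r * r' * s) / 2) = (π / 2 + arcsin s) / √(1 - s ^ 2) := by
  have hpos : ∀ m : ℝ, 0 < 1 + m ^ 2 - 2 * m * s := fun m => by
    nlinarith [sq_nonneg (m - s), hs.1, hs.2]
  have h1 : ∀ r ∈ Set.Ioi (0:ℝ), ∫ r' in Set.Ioi (0 : ℝ),
      Real.exp (-(r ^ 2 + r' ^ 2 - 2 * r * r' * s) / 2) =
      ∫ m in Set.Ioi (0:ℝ), r * Real.exp (-((1 + m ^ 2 - 2 * m * s) * r ^ 2) / 2) := by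
    intro r hr
    have := integral_comp_mul_left_Ioi'
      (fun r' => Real.exp (-(r ^ 2 + r' ^ 2 - 2 * r * r' * s) / 2)) 0 (b := r) hr
    rw [mul_zero] at this
    rw [← this, smul_eq_mul, ← integral_const_mul]
    congr 1; ext m; congr 2; ring
  rw [setIntegral_congr_fun measurableSet_Ioi h1, integral_integral_swap]
  · rw [← (lin_m hs).2]
    exact setIntegral_congr_fun measurableSet_Ioi fun m _ => (lin_r (hpos m)).2
  · rw [integrable_prod_iff']
    · refine ⟨Filter.Eventually.of_forall fun m => (lin_r (hpos m)).1, ?_⟩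
      refine (lin_m hs).1.congr_fun (fun m _ => ?_) measurableSet_Ioi
      refine (lin_r (hpos m)).2.symm.trans ?_
      refine setIntegral_congr_fun measurableSet_Ioi fun r hr => ?_
      exact (Real.norm_of_nonneg (mul_nonneg (le_of_lt hr) (exp_pos _).le)).symm
    · refine Continuous.aestronglyMeasurable ?_
      unfold Function.uncurry
      fun_prop

lemma psi_zero : psiTwo 0 = π / 2 := by
  have h : ∀ t ∈ Set.Ioo (0:ℝ) 1, ∫ r in Set.Ioi (0 : ℝ), ∫ r' in Set.Ioi (0 : ℝ),
      Real.exp (-(r ^ 2 + r' ^ 2 - 2 * r * r' * t * 0) / 2) = π / 2 := by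
    intro t _
    have := double_int (s := 0) (by norm_num)
    simpa using this
  rw [psiTwo, setIntegral_congr_fun measurableSet_Ioo h]
  simp

lemma psi_formula {α : ℝ} (hα : α ∈ Set.Icc (-1 : ℝ) 1) :
    α * psiTwo α = π / 2 * arcsin α + arcsin α ^ 2 / 2 := by
  rcases eq_or_ne α 0 with rfl | h0
  · simp
  have hmem : ∀ t ∈ Set.Ioo (0:ℝ) 1, t * α ∈ Set.Ioo (-1:ℝ) 1 := by
    intro t ht
    rw [Set.mem_Ioo, ← abs_lt, abs_mul, abs_of_pos ht.1]
    have := abs_le.2 hα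
    nlinarith [ht.1, ht.2, abs_nonneg α]
  have h : ∀ t ∈ Set.Ioo (0:ℝ) 1, ∫ r in Set.Ioi (0 : ℝ), ∫ r' in Set.Ioi (0 : ℝ),
      Real.exp (-(r ^ 2 + r' ^ 2 - 2 * r * r' * t * α) / 2) =
        (π / 2 + arcsin (t * α)) / √(1 - (t * α) ^ 2) := by
    intro t ht
    rw [← double_int (hmem t ht)]
    simp only [mul_assoc]
  have hd : ∀ t ∈ Set.Ioo (0:ℝ) 1, HasDerivAt
      (fun t => (π / 2 * arcsin (t * α) + arcsin (t * α) ^ 2 / 2) / α)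
      ((π / 2 + arcsin (t * α)) / √(1 - (t * α) ^ 2)) t := by
    intro t ht
    have hm := hmem t ht
    have h1 : HasDerivAt (fun t => t * α) α t := by
      simpa using (hasDerivAt_id t).mul_const α
    have h2 : HasDerivAt (fun t => arcsin (t * α)) (1 / √(1 - (t * α) ^ 2) * α) t :=
      HasDerivAt.comp (h₂ := arcsin) t (hasDerivAt_arcsin hm.1.ne' hm.2.ne) h1
    refine (((h2.const_mul (π / 2)).add ((h2.pow 2).div_const 2)).div_const α).congr_deriv ?_
    field_simp
    norm_num
  have hc : ContinuousOn (fun t => (π / 2 * arcsin (t * α) + arcsin (t * α) ^ 2 / 2) / α)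
      (Set.Icc 0 1) := by
    have : Continuous fun t : ℝ => arcsin (t * α) := continuous_arcsin.comp (by fun_prop)
    exact Continuous.continuousOn (by fun_prop)
  have hp : ∀ t ∈ Set.Ioo (0:ℝ) 1, 0 ≤ (π / 2 + arcsin (t * α)) / √(1 - (t * α) ^ 2) :=
    fun t _ => div_nonneg (by linarith [neg_pi_div_two_le_arcsin (t * α)]) (sqrt_nonneg _)
  have hi := intervalIntegral.integrableOn_deriv_of_nonneg hc hd hp
  have hv := intervalIntegral.integral_eq_sub_of_hasDerivAt_of_le zero_le_one hc hd
    ((intervalIntegrable_iff_integrableOn_Ioc_of_le zero_le_one).2 hi)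
  rw [psiTwo, setIntegral_congr_fun measurableSet_Ioo h, ← integral_Ioc_eq_integral_Ioo,
    ← intervalIntegral.integral_of_le zero_le_one, hv]
  simp
  field_simp

/-- `A / sin A ≤ π / 2`. -/
lemma arcsin_bound {α : ℝ} (h0 : 0 ≤ α) (h1 : α ≤ 1) : arcsin α ≤ π / 2 * α := by
  have h := mul_le_sin (arcsin_nonneg.2 h0) (arcsin_le_pi_div_two α)
  rw [sin_arcsin (by linarith) h1] at h
  have hp := pi_pos
  have : arcsin α = π / 2 * (2 / π * arcsin α) := by field_simp
  rw [this]
  gcongr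

lemma psi_le {α : ℝ} (hα : α ∈ Set.Icc (-1 : ℝ) 1) : psiTwo α ≤ 2 * π := by
  have hp := pi_pos
  have hp4 := pi_le_four
  have hf := psi_formula hα
  have hA := arcsin_le_pi_div_two α
  have hA' := neg_pi_div_two_le_arcsin α
  rcases lt_trichotomy α 0 with h | rfl | h
  · have hb := arcsin_bound (α := -α) (by linarith) (by linarith [hα.1])
    rw [arcsin_neg] at hb
    have : 0 ≤ arcsin α ^ 2 := sq_nonneg _
    have h2 : (-α) * psiTwo α ≤ (-α) * (π / 2 * (π / 2)) := by nlinarith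
    have h3 := le_of_mul_le_mul_left h2 (by linarith)
    nlinarith
  · rw [psi_zero]; linarith
  · have hb := arcsin_bound h.le hα.2
    have h4 : 0 ≤ arcsin α := arcsin_nonneg.2 h.le
    have h2 : α * psiTwo α ≤ α * (π / 2 * (π / 2) + π / 2 * (π / 2) / 2) := by nlinarith
    have h3 := le_of_mul_le_mul_left h2 h
    nlinarith

lemma psi_sym {α : ℝ} (hα : α ∈ Set.Icc (-1 : ℝ) 1) : psiTwo α + psiTwo (-α) ≤ π ^ 2 / 2 := by
  wlog h : 0 ≤ α generalizing α
  · have := this (α := -α) ⟨by linarith [hα.2], by linarith [hα.1]⟩ (by linarith)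
    rw [neg_neg] at this
    linarith
  have hp := pi_pos
  rcases h.eq_or_lt with rfl | h
  · rw [neg_zero, psi_zero]; nlinarith [pi_gt_three]
  have hf := psi_formula hα
  have hf' := psi_formula (α := -α) ⟨by linarith [hα.2], by linarith [hα.1]⟩
  rw [arcsin_neg] at hf'
  have hb := arcsin_bound h.le hα.2
  have h2 : α * (psiTwo α + psiTwo (-α)) ≤ α * (π ^ 2 / 2) := by nlinarith
  exact le_of_mul_le_mul_left h2 h


lemma main_calc (f f' g g' k : ℝ → ℝ)
    (hf : ∀ a, HasDerivAt f (f' a) a) (hg : ∀ a, HasDerivAt g (g' a) a)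
    (cf : Continuous f') (cg : Continuous g')
    (pf : Function.Periodic f (2 * π)) (pg : Function.Periodic g (2 * π))
    (pg' : Function.Periodic g' (2 * π)) (pk : Function.Periodic k (2 * π))
    (ek : ∀ s, k (-s) = k s)
    (hk : ∀ s ∈ Set.Icc 0 (2 * π), k s = 3 * π ^ 2 / 8 - π * s + s ^ 2 / 2) :
    ∫ a in (0:ℝ)..(2 * π), ∫ b in (0:ℝ)..(2 * π), f' a * g' b * k (a - b) =
      2 * π * (∫ a in (0:ℝ)..(2 * π), f a * g a) -
        (∫ a in (0:ℝ)..(2 * π), f a) * (∫ a in (0:ℝ)..(2 * π), g a) := by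
  have hpi := pi_pos
  have cf0 : Continuous f := continuous_iff_continuousAt.2 fun a => (hf a).continuousAt
  have cg0 : Continuous g := continuous_iff_continuousAt.2 fun a => (hg a).continuousAt
  set M := ∫ a in (0:ℝ)..(2 * π), g a with hM
  let P : ℝ → ℝ := fun s => 3 * π ^ 2 / 8 - π * s + s ^ 2 / 2
  have hP : ∀ s, HasDerivAt P (s - π) s := by
    intro s
    refine ((((hasDerivAt_id s).const_mul π).const_sub _).add
      (((hasDerivAt_pow 2 s)).div_const 2)).congr_deriv ?_
    simp; ring
  let J : ℝ → ℝ := fun a => ∫ s in (0:ℝ)..(2 * π), P s * g' (s + a)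
  have hJper : J (2 * π) = J 0 := by
    refine intervalIntegral.integral_congr fun s _ => ?_
    simp only [pg' s, add_zero]
  have hinner : ∀ a, ∫ b in (0:ℝ)..(2 * π), f' a * g' b * k (a - b) = J a * f' a := by
    intro a
    have hper : Function.Periodic (fun b => f' a * g' b * k (a - b)) (2 * π) := by
      intro b
      have : k (a - (b + 2 * π)) = k (a - b) := by
        rw [← sub_sub]; exact pk.sub_eq (a - b)
      simp only [pg' b, this]
    have h1 := hper.intervalIntegral_add_eq 0 a
    rw [zero_add] at h1
    rw [h1, mul_comm (J a), ← intervalIntegral.integral_const_mul]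
    have h2 := intervalIntegral.integral_comp_add_right (a := 0) (b := 2 * π)
      (fun b => f' a * g' b * k (a - b)) a
    rw [zero_add, add_comm (2 * π) a] at h2
    rw [← h2]
    refine intervalIntegral.integral_congr fun s hs => ?_
    rw [Set.uIcc_of_le (by linarith)] at hs
    have : k (a - (s + a)) = P s := by
      rw [show a - (s + a) = -s by ring, ek, hk s hs]
    simp only [this]
    ring
  let Q : ℝ → ℝ := fun x => ∫ b in (0:ℝ)..x, b * g b
  have cbg : Continuous fun b => b * g b := by fun_prop
  have hQ : ∀ x, HasDerivAt Q (x * g x) x := fun x =>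
    (cbg.integral_hasStrictDerivAt 0 x).hasDerivAt
  have hJ : ∀ a, J a = (a + π) * M - (Q (a + 2 * π) - Q a) := by
    intro a
    have hv : ∀ x, HasDerivAt (fun s => g (s + a)) (g' (x + a)) x := fun x =>
      (hg (x + a)).comp_add_const x a
    have h1 : J a = _ := intervalIntegral.integral_mul_deriv_eq_deriv_mul
      (fun x _ => hP x) (fun x _ => hv x)
      (Continuous.intervalIntegrable (by fun_prop) _ _)
      (Continuous.intervalIntegrable (by fun_prop) _ _)
    rw [h1]
    have h2 := intervalIntegral.integral_comp_add_right (a := 0) (b := 2 * π)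
      (fun b => (b - a - π) * g b) a
    rw [zero_add, add_comm (2 * π) a] at h2
    have h3 : ∫ x in (0:ℝ)..(2 * π), (x - π) * g (x + a) =
        ∫ x in (0:ℝ)..(2 * π), (x + a - a - π) * g (x + a) := by
      simp only [add_sub_cancel_right]
    have h4 : ∫ b in a..(a + 2 * π), (b - a - π) * g b =
        (∫ b in a..(a + 2 * π), b * g b) - (a + π) * ∫ b in a..(a + 2 * π), g b := by
      rw [← intervalIntegral.integral_const_mul, ← intervalIntegral.integral_sub
        (cbg.intervalIntegrable _ _) (Continuous.intervalIntegrable (by fun_prop) _ _)]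
      refine intervalIntegral.integral_congr fun s _ => ?_
      ring
    have h5 : ∫ b in a..(a + 2 * π), g b = M := by
      rw [pg.intervalIntegral_add_eq a 0, zero_add]
    have h6 : ∫ b in a..(a + 2 * π), b * g b = Q (a + 2 * π) - Q a :=
      (intervalIntegral.integral_interval_sub_left (cbg.intervalIntegrable _ _)
        (cbg.intervalIntegrable _ _)).symm
    rw [h3, h2, h4, h5, h6]
    have h7 : g (2 * π + a) = g (0 + a) := by rw [add_comm, pg a, zero_add]
    rw [h7]
    simp only [P]
    ring
  have hJd : ∀ a, HasDerivAt J (M - 2 * π * g a) a := by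
    intro a
    have h1 : HasDerivAt (fun a => (a + π) * M - (Q (a + 2 * π) - Q a))
        (1 * M - ((a + 2 * π) * g (a + 2 * π) - a * g a)) a :=
      (((hasDerivAt_id a).add_const π).mul_const M).sub
        (((hQ (a + 2 * π)).comp_add_const a (2 * π)).sub (hQ a))
    rw [show J = _ from funext hJ]
    refine h1.congr_deriv ?_
    rw [pg a]; ring
  have h1 := intervalIntegral.integral_mul_deriv_eq_deriv_mul (a := 0) (b := 2 * π)
      (fun x _ => hJd x) (fun x _ => hf x)
      (Continuous.intervalIntegrable (by fun_prop) _ _)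
      (Continuous.intervalIntegrable (by fun_prop) _ _)
  simp only [hinner]
  have hf0 : f (2 * π) = f 0 := by have := pf 0; rwa [zero_add] at this
  rw [h1, hJper, hf0, sub_self, zero_sub, ← intervalIntegral.integral_const_mul,
    ← intervalIntegral.integral_mul_const, ← intervalIntegral.integral_neg,
    ← intervalIntegral.integral_sub (Continuous.intervalIntegrable (by fun_prop) _ _)
      (Continuous.intervalIntegrable (by fun_prop) _ _)]
  refine intervalIntegral.integral_congr fun s _ => ?_
  ring

lemma cos_mem (s : ℝ) : cos s ∈ Set.Icc (-1:ℝ) 1 := ⟨neg_one_le_cos s, cos_le_one s⟩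

lemma k_formula : ∀ s ∈ Set.Icc 0 (2 * π),
    cos s * psiTwo (cos s) = 3 * π ^ 2 / 8 - π * s + s ^ 2 / 2 := by
  intro s hs
  rw [psi_formula (cos_mem s), arcsin_eq_pi_div_two_sub_arccos]
  rcases le_total s π with h | h
  · rw [arccos_cos hs.1 h]; ring
  · rw [show cos s = cos (2 * π - s) by rw [cos_two_pi_sub],
      arccos_cos (by linarith [hs.2]) (by linarith)]
    ring

lemma mass_lt :
    (∫ x, (∫ y, psiTwo ⟪x, y⟫ ∂(sphereUniform 2)) ∂(sphereUniform 2)) < π := by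
  have hpi := pi_pos
  simp only [sphere_int, inner_e]
  have hper : Function.Periodic (fun s => psiTwo (cos s)) (2 * π) := fun s => by
    simp only [cos_add_two_pi]
  set I := ∫ s in (0:ℝ)..(2 * π), psiTwo (cos s) with hI
  have hin : ∀ a, ∫ b in (0:ℝ)..(2 * π), psiTwo (cos (a - b)) = I := by
    intro a
    have h1 := intervalIntegral.integral_comp_sub_right (a := 0) (b := 2 * π)
      (fun s => psiTwo (cos s)) a
    have h2 := hper.intervalIntegral_add_eq (0 - a) 0
    rw [zero_add, show 0 - a + 2 * π = 2 * π - a by ring] at h2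
    rw [hI, ← h2, ← h1]
    refine intervalIntegral.integral_congr fun s _ => ?_
    rw [← cos_neg, neg_sub]
  have hshift : ∫ s in (0:ℝ)..(2 * π), psiTwo (-cos s) = I := by
    have h1 := intervalIntegral.integral_comp_add_right (a := 0) (b := 2 * π)
      (fun s => psiTwo (cos s)) π
    have h2 := hper.intervalIntegral_add_eq (0 + π) 0
    rw [zero_add (2 * π), show 0 + π + 2 * π = 2 * π + π by ring] at h2
    rw [hI, ← h2, ← h1]
    simp only [cos_add_pi]
  have hIle : I ≤ π / 2 * π ^ 2 := by
    by_cases hint : IntervalIntegrable (fun s => psiTwo (cos s)) volume 0 (2 * π)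
    · by_cases hint' : IntervalIntegrable (fun s => psiTwo (-cos s)) volume 0 (2 * π)
      · have h1 := intervalIntegral.integral_add hint hint'
        have h2 : ∫ s in (0:ℝ)..(2 * π), (psiTwo (cos s) + psiTwo (-cos s)) ≤
            ∫ s in (0:ℝ)..(2 * π), π ^ 2 / 2 :=
          intervalIntegral.integral_mono_on (by linarith) (hint.add hint')
            intervalIntegrable_const fun s _ => psi_sym (cos_mem s)
        rw [h1, hshift, intervalIntegral.integral_const, smul_eq_mul] at h2
        nlinarith
      · rw [← hshift, intervalIntegral.integral_undef hint']; positivity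
    · rw [hI, intervalIntegral.integral_undef hint]; positivity
  simp only [hin]
  rw [intervalIntegral.integral_const, smul_eq_mul, sub_zero]
  have h4 : π < 4 := lt_trans pi_lt_d2 (by norm_num)
  have : (2 * π)⁻¹ * (2 * π * ((2 * π)⁻¹ * I)) = I / (2 * π) := by field_simp
  rw [this, div_lt_iff₀ (by positivity)]
  have : π ^ 2 * π < π ^ 2 * 4 := by gcongr
  nlinarith

noncomputable def e' (a : ℝ) : E2 := !₂[-sin a, cos a]

lemma e_deriv (a : ℝ) : HasDerivAt e (e' a) a := by
  have h : HasDerivAt (fun t => (![cos t, sin t] : Fin 2 → ℝ)) ![-sin a, cos a] a := by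
    rw [hasDerivAt_pi]
    intro i
    fin_cases i
    · simpa using hasDerivAt_cos a
    · simpa using hasDerivAt_sin a
  exact (PiLp.continuousLinearEquiv 2 ℝ (fun _ : Fin 2 => ℝ)).symm.toContinuousLinearMap.hasFDerivAt.comp_hasDerivAt a h

lemma e_contDiff : ContDiff ℝ 1 e := by
  rw [contDiff_euclidean]
  intro i
  fin_cases i
  · simpa [e] using contDiff_cos
  · simpa [e] using contDiff_sin

lemma e_ne (a : ℝ) : e a ≠ 0 := by
  intro h
  have := norm_e a
  rw [h] at this; simp at this

lemma inner_e' (a b : ℝ) : ⟪e' a, e' b⟫ = cos (a - b) := by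
  simp [e', PiLp.inner_apply, Fin.sum_univ_two, cos_sub]; ring

lemma grad_formula (u : E2 → ℝ) (hu : ContDiffOn ℝ 1 u {(0 : E2)}ᶜ)
    (hh : ∀ r : ℝ, 0 < r → ∀ x : E2, x ≠ 0 → u (r • x) = u x) (a : ℝ) :
    gradient u (e a) = deriv (fun t => u (e t)) a • e' a ∧
    HasDerivAt (fun t => u (e t)) (deriv (fun t => u (e t)) a) a := by
  have hd : DifferentiableAt ℝ u (e a) :=
    (hu.contDiffAt (isOpen_compl_singleton.mem_nhds (e_ne a))).differentiableAt (by norm_num)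
  have hF := hd.hasGradientAt.hasFDerivAt
  have h1 : HasDerivAt (fun t => u (e t)) ⟪gradient u (e a), e' a⟫ a := by
    exact (hF.comp_hasDerivAt a (e_deriv a)).congr_deriv
      (InnerProductSpace.toDual_apply_apply ..)
  have h2 : ⟪gradient u (e a), e a⟫ = 0 := by
    have hl : HasDerivAt (fun t : ℝ => t • e a) (e a) 1 := by
      simpa using (hasDerivAt_id (1:ℝ)).smul_const (e a)
    have hF' : HasFDerivAt u (InnerProductSpace.toDual ℝ E2 (gradient u (e a)))
        ((1:ℝ) • e a) := by rwa [one_smul]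
    have h3 := hF'.comp_hasDerivAt (1:ℝ) hl
    have h4 : (u ∘ fun t : ℝ => t • e a) =ᶠ[nhds 1] fun _ => u (e a) := by
      filter_upwards [lt_mem_nhds (zero_lt_one (α := ℝ))] with t ht
      exact hh t ht _ (e_ne a)
    have h5 := (hasDerivAt_const (1:ℝ) (u (e a))).congr_of_eventuallyEq h4
    have := h3.unique h5
    simpa using this
  refine ⟨?_, h1.differentiableAt.hasDerivAt⟩
  rw [h1.deriv]
  set G := gradient u (e a)
  simp only [e, e', PiLp.inner_apply, Fin.sum_univ_two] at h2 ⊢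
  simp at h2 ⊢
  have hsc := sin_sq_add_cos_sq a
  ext i
  fin_cases i
  · simp
    linear_combination (-G 0) * hsc + cos a * h2
  · simp
    linear_combination (-G 1) * hsc + sin a * h2

lemma cov_id (u v : E2 → ℝ) (hu : ContDiffOn ℝ 1 u {(0 : E2)}ᶜ)
    (hv : ContDiffOn ℝ 1 v {(0 : E2)}ᶜ)
    (hhu : ∀ r : ℝ, 0 < r → ∀ x : E2, x ≠ 0 → u (r • x) = u x)
    (hhv : ∀ r : ℝ, 0 < r → ∀ x : E2, x ≠ 0 → v (r • x) = v x) :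
    (∫ x, u x * v x ∂(sphereUniform 2)) -
          (∫ x, u x ∂(sphereUniform 2)) * (∫ x, v x ∂(sphereUniform 2)) =
        ∫ x, (∫ y, ⟪gradient u x, gradient v y⟫ * psiTwo ⟪x, y⟫
          ∂(sphereUniform 2)) ∂(sphereUniform 2) := by
  have cu : ContDiff ℝ 1 (fun t => u (e t)) := hu.comp_contDiff e_contDiff e_ne
  have cv : ContDiff ℝ 1 (fun t => v (e t)) := hv.comp_contDiff e_contDiff e_ne
  have pu : Function.Periodic (fun t => u (e t)) (2 * π) := fun t => by simp only [e_periodic t]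
  have pv : Function.Periodic (fun t => v (e t)) (2 * π) := fun t => by simp only [e_periodic t]
  have pv' : Function.Periodic (deriv fun t => v (e t)) (2 * π) := by
    intro t
    rw [← deriv_comp_add_const]
    congr 1
    funext s
    exact pv s
  have key := main_calc (fun t => u (e t)) (deriv fun t => u (e t)) (fun t => v (e t))
    (deriv fun t => v (e t)) (fun s => cos s * psiTwo (cos s))
    (fun a => (grad_formula u hu hhu a).2) (fun a => (grad_formula v hv hhv a).2)
    (cu.continuous_deriv le_rfl) (cv.continuous_deriv le_rfl) pu pv pv'
    (fun s => by simp only [cos_add_two_pi]) (fun s => by simp only [cos_neg]) k_formula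
  simp only [sphere_int, inner_e]
  have h : ∀ a b, ⟪gradient u (e a), gradient v (e b)⟫ * psiTwo (cos (a - b)) =
      deriv (fun t => u (e t)) a * deriv (fun t => v (e t)) b *
        (cos (a - b) * psiTwo (cos (a - b))) := by
    intro a b
    rw [(grad_formula u hu hhu a).1, (grad_formula v hv hhv b).1, inner_smul_left,
      inner_smul_right, inner_e']
    simp only [conj_trivial]
    ring
  simp only [h]
  rw [intervalIntegral.integral_const_mul, key]
  have hpi := pi_pos
  field_simp

end CovCircle

/-- Covariance representation on the circle: `ψ₂ ≤ 2π`, the total mass `c₂ < π`,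
and the covariance identity holds for `C¹` 0-homogeneous functions. -/
theorem statement9 :
    (∀ α ∈ Set.Icc (-1 : ℝ) 1, psiTwo α ≤ 2 * π) ∧
    (∫ x, (∫ y, psiTwo ⟪x, y⟫ ∂(sphereUniform 2)) ∂(sphereUniform 2)) < π ∧
    (∀ u v : EuclideanSpace ℝ (Fin 2) → ℝ,
      ContDiffOn ℝ 1 u {(0 : EuclideanSpace ℝ (Fin 2))}ᶜ →
      ContDiffOn ℝ 1 v {(0 : EuclideanSpace ℝ (Fin 2))}ᶜ →
      (∀ r : ℝ, 0 < r → ∀ x : EuclideanSpace ℝ (Fin 2), x ≠ 0 → u (r • x) = u x) →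
      (∀ r : ℝ, 0 < r → ∀ x : EuclideanSpace ℝ (Fin 2), x ≠ 0 → v (r • x) = v x) →
      (∫ x, u x * v x ∂(sphereUniform 2)) -
          (∫ x, u x ∂(sphereUniform 2)) * (∫ x, v x ∂(sphereUniform 2)) =
        ∫ x, (∫ y, ⟪gradient u x, gradient v y⟫ * psiTwo ⟪x, y⟫
          ∂(sphereUniform 2)) ∂(sphereUniform 2)) := by
  exact ⟨fun _ h => CovCircle.psi_le h, CovCircle.mass_lt, fun u v hu hv hhu hhv =>
    CovCircle.cov_id u v hu hv hhu hhv⟩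
end
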